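/- arXiv:1503.01592 — 2 statements merged into one kernel-verified Lean document; each statement's English description precedes it below -/
import Mathlib

section
/- Let G be a graph containing a cycle. Then the connected order of any bramble of G is at most tw(G)·⌊ℓ(G)/2⌋ + 1, where tw(G) is the tree-width of G and ℓ(G) is the smallest ℓ such that cycles of length at most ℓ generate the cycle space of G. -/
open SimpleGraph

universe u

/-- `x` and `y` are joined by a walk in `G` all of whose vertices lie in `S`. -/
def ConnIn {V : Type u} (G : SimpleGraph V) (S : Set V) (x y : V) : Prop :=
  ∃ p : G.Walk x y, ∀ v ∈ p.support, v ∈ S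

/-- `S` is a (nonempty) connected vertex set of `G`, i.e. `G[S]` is connected. -/
def IsConnSet {V : Type u} (G : SimpleGraph V) (S : Set V) : Prop :=
  S.Nonempty ∧ ∀ x ∈ S, ∀ y ∈ S, ConnIn G S x y

/-- A tree-decomposition of `G` over the tree `T`. -/
structure TreeDecomp {V ι : Type u} (G : SimpleGraph V) (T : SimpleGraph ι) where
  isTree : T.IsTree
  bag : ι → Set V
  exists_bag : ∀ v : V, ∃ t, v ∈ bag t
  exists_bag_adj : ∀ ⦃u v : V⦄, G.Adj u v → ∃ t, u ∈ bag t ∧ v ∈ bag t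
  bag_sep : ∀ ⦃t₁ t₃ : ι⦄ (p : T.Walk t₁ t₃), p.IsPath → ∀ t₂ ∈ p.support,
      bag t₁ ∩ bag t₃ ⊆ bag t₂

/-- The union of the bags `B u` over `u ∈ A`. -/
def unionBags {V ι : Type u} (B : ι → Set V) (A : Set ι) : Set V := ⋃ u ∈ A, B u

/-- `s` is a descendant of `t` in the tree `T` rooted at `r`:
`t` lies on the (unique) `r`–`s` path. -/
def Desc {ι : Type u} (T : SimpleGraph ι) (r t s : ι) : Prop :=
  ∃ p : T.Walk r s, p.IsPath ∧ t ∈ p.support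

/-- The set of descendants of `t` (the subtree `T_t`). -/
def descSet {ι : Type u} (T : SimpleGraph ι) (r t : ι) : Set ι := {s | Desc T r t s}

/-- `s` is a child of `t` in the tree `T` rooted at `r`. -/
def IsChild {ι : Type u} (T : SimpleGraph ι) (r t s : ι) : Prop :=
  T.Adj t s ∧ Desc T r t s

/-- The vertex set of the component of `t₁` in `T` minus the edge `t₁t₂`. -/
def Side {ι : Type u} (T : SimpleGraph ι) (t₁ t₂ : ι) : Set ι :=
  {u | ∃ p : T.Walk u t₁, p.IsPath ∧ t₂ ∉ p.support}

/-- The family of bags `B` is stable: for every tree edge `t₁t₂`, both sides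
induce connected subgraphs of `G`. -/
def StableBags {V ι : Type u} (G : SimpleGraph V) (T : SimpleGraph ι) (B : ι → Set V) : Prop :=
  ∀ ⦃t₁ t₂ : ι⦄, T.Adj t₁ t₂ → IsConnSet G (unionBags B (Side T t₁ t₂))

def TreeDecomp.Stable {V ι : Type u} {G : SimpleGraph V} {T : SimpleGraph ι}
    (td : TreeDecomp G T) : Prop :=
  StableBags G T td.bag

/-- `P` is a `t`-admissible path (w.r.t. the root `r` and bags `B`): a shortest
path lying in `V_{T_t}` joining two distinct components of `G[B t]`. -/
structure IsAdmissible {V ι : Type u} (G : SimpleGraph V) (T : SimpleGraph ι)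
    (B : ι → Set V) (r t : ι) {x y : V} (P : G.Walk x y) : Prop where
  isPath : P.IsPath
  support_sub : ∀ v ∈ P.support, v ∈ unionBags B (descSet T r t)
  fst_mem : x ∈ B t
  snd_mem : y ∈ B t
  not_conn : ¬ ConnIn G (B t) x y
  minimal : ∀ ⦃x' y' : V⦄ (Q : G.Walk x' y'), Q.IsPath →
      (∀ v ∈ Q.support, v ∈ unionBags B (descSet T r t)) →
      x' ∈ B t → y' ∈ B t → ¬ ConnIn G (B t) x' y' → P.length ≤ Q.length

/-- The updated bags obtained by adding the path `P` as in `(*)`: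
`W_u = V_u ∪ (V(P) ∩ V_{T_u})` for descendants `u` of `t`, and `W_u = V_u` otherwise. -/
def updatedBag {V ι : Type u} (T : SimpleGraph ι) (B : ι → Set V) (r t : ι)
    {G : SimpleGraph V} {x y : V} (P : G.Walk x y) (u : ι) : Set V :=
  B u ∪ {v | Desc T r t u ∧ v ∈ P.support ∧ v ∈ unionBags B (descSet T r u)}

/-- The tree-width of `G`: the least `k` such that `G` has a tree-decomposition
all of whose bags have at most `k + 1` vertices. -/
noncomputable def treewidth {V : Type u} (G : SimpleGraph V) : ℕ :=
  sInf {k | ∃ (ι : Type u) (T : SimpleGraph ι) (td : TreeDecomp G T),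
    ∀ t, (td.bag t).ncard ≤ k + 1}

/-- A tree-decomposition is connected if every bag is a connected vertex set. -/
def TreeDecomp.IsConn {V ι : Type u} {G : SimpleGraph V} {T : SimpleGraph ι}
    (td : TreeDecomp G T) : Prop :=
  ∀ t, IsConnSet G (td.bag t)

/-- The connected tree-width of `G`. -/
noncomputable def ctw {V : Type u} (G : SimpleGraph V) : ℕ :=
  sInf {k | ∃ (ι : Type u) (T : SimpleGraph ι) (td : TreeDecomp G T),
    td.IsConn ∧ ∀ t, (td.bag t).ncard ≤ k + 1}

/-- The weak connected tree-width of `G`: the least `k` such that `G` has a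
tree-decomposition each of whose bags is contained in a connected set of at
most `k + 1` vertices. -/
noncomputable def wctw {V : Type u} (G : SimpleGraph V) : ℕ :=
  sInf {k | ∃ (ι : Type u) (T : SimpleGraph ι) (td : TreeDecomp G T),
    ∀ t, ∃ X, td.bag t ⊆ X ∧ IsConnSet G X ∧ X.ncard ≤ k + 1}

/-- The characteristic vector over GF(2) of the edge set of a walk. -/
noncomputable def walkChar {V : Type u} {G : SimpleGraph V} {x y : V}
    (p : G.Walk x y) : Sym2 V → ZMod 2 :=
  fun e => by classical exact if e ∈ p.edges then 1 else 0

/-- The characteristic vectors of the cycles of `G` of length at most `ℓ`. -/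
def cycleChars {V : Type u} (G : SimpleGraph V) (ℓ : ℕ) : Set (Sym2 V → ZMod 2) :=
  {f | ∃ (v : V) (p : G.Walk v v), p.IsCycle ∧ p.length ≤ ℓ ∧ f = walkChar p}

/-- The cycles of length at most `ℓ` generate the cycle space of `G` over GF(2). -/
def GeneratesLE {V : Type u} (G : SimpleGraph V) (ℓ : ℕ) : Prop :=
  ∀ ⦃v : V⦄ (p : G.Walk v v), p.IsCycle →
    walkChar p ∈ Submodule.span (ZMod 2) (cycleChars G ℓ)

/-- `ℓ(G)`: the least `ℓ` such that the cycles of length at most `ℓ`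
generate the cycle space of `G`. -/
noncomputable def ellGraph {V : Type u} (G : SimpleGraph V) : ℕ :=
  sInf {ℓ | GeneratesLE G ℓ}

/-- `Γ` is a set of cycles of `G` generating its cycle space over GF(2). -/
def GeneratesSet {V : Type u} (G : SimpleGraph V) (Γ : Set (Σ v : V, G.Walk v v)) : Prop :=
  (∀ c ∈ Γ, c.2.IsCycle) ∧
  ∀ ⦃v : V⦄ (p : G.Walk v v), p.IsCycle →
    walkChar p ∈ Submodule.span (ZMod 2) {f | ∃ c ∈ Γ, f = walkChar c.2}

/-- A bramble: a collection of connected vertex sets, any two of which have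
connected union. -/
def IsBramble {V : Type u} (G : SimpleGraph V) (B : Set (Set V)) : Prop :=
  (∀ S ∈ B, IsConnSet G S) ∧ ∀ S ∈ B, ∀ S' ∈ B, IsConnSet G (S ∪ S')

/-- `X` is a connected cover of the bramble `B`. -/
def IsConnCover {V : Type u} (G : SimpleGraph V) (B : Set (Set V)) (X : Set V) : Prop :=
  IsConnSet G X ∧ ∀ S ∈ B, (X ∩ S).Nonempty

/-- The connected order of a bramble: the least size of a connected cover. -/
noncomputable def connOrder {V : Type u} (G : SimpleGraph V) (B : Set (Set V)) : ℕ :=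
  sInf {n | ∃ X, IsConnCover G B X ∧ X.ncard = n}

/-- The maximum connected order of a bramble of `G`. -/
noncomputable def cbn {V : Type u} (G : SimpleGraph V) : ℕ :=
  sSup {n | ∃ B, IsBramble G B ∧ connOrder G B = n}

/-- A geodesic cycle: a cycle containing a shortest `G`-path between any two
of its vertices. -/
def IsGeodesicCycle {V : Type u} (G : SimpleGraph V) {v : V} (p : G.Walk v v) : Prop :=
  p.IsCycle ∧ ∀ x ∈ p.support, ∀ y ∈ p.support,
    ∃ q : G.Walk x y, q.length = G.dist x y ∧ ∀ e ∈ q.edges, e ∈ p.edges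

/-- The graph obtained from `K_n` by subdividing every edge exactly `k` times:
the edge between `i < j` is replaced by the path
`i, ((i,j),0), ((i,j),1), …, ((i,j),k-1), j`. -/
def subK (n k : ℕ) : SimpleGraph (Fin n ⊕ ({p : Fin n × Fin n // p.1 < p.2} × Fin k)) :=
  SimpleGraph.fromRel fun u v =>
    match u, v with
    | Sum.inl i, Sum.inl j => i < j ∧ k = 0
    | Sum.inl i, Sum.inr (e, c) =>
        (e.val.1 = i ∧ (c : ℕ) = 0) ∨ (e.val.2 = i ∧ (c : ℕ) = k - 1)
    | Sum.inr (e, c), Sum.inr (e', c') => e = e' ∧ (c' : ℕ) = (c : ℕ) + 1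
    | _, _ => False

section ConnIn

variable {V : Type u} {G : SimpleGraph V} {S S' : Set V} {x y z : V}

theorem ConnIn.of_mem (hx : x ∈ S) : ConnIn G S x x :=
  ⟨.nil, by simpa using hx⟩

theorem ConnIn.of_adj (h : G.Adj x y) (hx : x ∈ S) (hy : y ∈ S) : ConnIn G S x y :=
  ⟨h.toWalk, by simp [hx, hy]⟩

theorem ConnIn.symm (h : ConnIn G S x y) : ConnIn G S y x := by
  obtain ⟨p, hp⟩ := h
  exact ⟨p.reverse, by simpa using hp⟩

theorem ConnIn.trans (h : ConnIn G S x y) (h' : ConnIn G S y z) : ConnIn G S x z := by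
  obtain ⟨p, hp⟩ := h
  obtain ⟨q, hq⟩ := h'
  refine ⟨p.append q, fun v hv => ?_⟩
  rw [Walk.mem_support_append_iff] at hv
  exact hv.elim (hp v) (hq v)

theorem ConnIn.mono (hS : S ⊆ S') (h : ConnIn G S x y) : ConnIn G S' x y := by
  obtain ⟨p, hp⟩ := h
  exact ⟨p, fun v hv => hS (hp v hv)⟩

theorem ConnIn.mem_left (h : ConnIn G S x y) : x ∈ S := by
  obtain ⟨p, hp⟩ := h
  exact hp x p.start_mem_support

theorem ConnIn.mem_right (h : ConnIn G S x y) : y ∈ S := h.symm.mem_left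

/-- A walk in `S` stays inside the part of `S` it can reach. -/
theorem ConnIn.connIn_reach (h : ConnIn G S x y) : ConnIn G {z | ConnIn G S x z} x y := by
  classical
  obtain ⟨p, hp⟩ := h
  exact ⟨p, fun v hv => ⟨p.takeUntil v hv, fun w hw =>
    hp w (p.support_takeUntil_subset_support hv hw)⟩⟩

/-- A property closed under the edges of `G[S]` propagates along connections in `S`. -/
theorem ConnIn.induction (h : ConnIn G S x y) {P : V → Prop} (hx : P x)
    (hP : ∀ a ∈ S, ∀ b ∈ S, G.Adj a b → P a → P b) : P y := by
  obtain ⟨p, hp⟩ := h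
  induction p with
  | nil => exact hx
  | cons hadj q ih =>
    simp only [Walk.support_cons, List.mem_cons, forall_eq_or_imp] at hp
    exact ih (hP _ hp.1 _ (hp.2 _ q.start_mem_support) hadj hx) hp.2

/-- A connection out of `U` has a last edge leaving `U`. -/
theorem ConnIn.exists_last_exit (h : ConnIn G S x y) {U : Set V} (hx : x ∈ U) (hy : y ∉ U) :
    ∃ a ∈ U, ∃ b, b ∉ U ∧ G.Adj a b ∧ ConnIn G (S \ U) b y := by
  obtain ⟨p, hp⟩ := h
  suffices ∀ {x y : V} (p : G.Walk x y), (∀ v ∈ p.support, v ∈ S) → y ∉ U →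
      (∃ a ∈ U, ∃ b, b ∉ U ∧ G.Adj a b ∧ ConnIn G (S \ U) b y) ∨ ConnIn G (S \ U) x y from
    (this p hp hy).resolve_right fun h => h.mem_left.2 hx
  intro x y p hp hy
  induction p with
  | nil => exact .inr (ConnIn.of_mem ⟨hp _ (by simp), hy⟩)
  | @cons a b c hadj q ih =>
    simp only [Walk.support_cons, List.mem_cons, forall_eq_or_imp] at hp
    rcases ih hp.2 hy with h | h
    · exact .inl h
    · by_cases ha : a ∈ U
      · exact .inl ⟨a, ha, b, h.mem_left.2, hadj, h⟩
      · exact .inr ((ConnIn.of_adj (S := S \ U) hadj ⟨hp.1, ha⟩ h.mem_left).trans h)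

theorem IsConnSet.exists_touch (hS : S.Nonempty) (hS' : S'.Nonempty)
    (h : IsConnSet G (S ∪ S')) : ∃ a ∈ S, ∃ b ∈ S', a = b ∨ G.Adj a b := by
  obtain ⟨x, hx⟩ := hS
  obtain ⟨y, hy⟩ := hS'
  by_contra! hcon
  have : y ∈ S := (h.2 x (.inl hx) y (.inr hy)).induction hx fun a ha b hb hab haS =>
    hb.resolve_right fun hbS => (hcon a haS b hbS).2 hab
  exact (hcon y this y hy).1 rfl

theorem IsConnSet.union (hS : IsConnSet G S) (hS' : IsConnSet G S') {a b : V} (ha : a ∈ S)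
    (hb : b ∈ S') (hab : a = b ∨ G.Adj a b) : IsConnSet G (S ∪ S') := by
  have key : ConnIn G (S ∪ S') a b := by
    rcases hab with rfl | hab
    · exact .of_mem (.inl ha)
    · exact .of_adj hab (.inl ha) (.inr hb)
  have h1 : ∀ x ∈ S ∪ S', ConnIn G (S ∪ S') x a := by
    rintro x (hx | hx)
    · exact (hS.2 x hx a ha).mono Set.subset_union_left
    · exact ((hS'.2 x hx b hb).mono Set.subset_union_right).trans key.symm
  exact ⟨⟨a, .inl ha⟩, fun x hx y hy => (h1 x hx).trans (h1 y hy).symm⟩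

/-- If no edge of `G[S]` crosses `L`, a connected set `S` meeting `L` lies in `L`. -/
theorem IsConnSet.subset_of_mem (hS : IsConnSet G S) {L : Set V} (hx : x ∈ S) (hxL : x ∈ L)
    (hL : ∀ a ∈ S, ∀ b ∈ S, G.Adj a b → a ∈ L → b ∈ L) : S ⊆ L :=
  fun y hy => (hS.2 x hx y hy).induction hxL hL

theorem IsConnSet.singleton (x : V) : IsConnSet G {x} := by
  refine ⟨⟨x, rfl⟩, ?_⟩
  rintro a rfl b rfl
  exact .of_mem rfl

end ConnIn

section Tree

variable {ι : Type u} {T : SimpleGraph ι}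

/-- `A` contains every path of `T` between two of its nodes. -/
def IsPathConvex (T : SimpleGraph ι) (A : Set ι) : Prop :=
  ∀ ⦃s⦄, s ∈ A → ∀ ⦃t⦄, t ∈ A → ∀ p : T.Walk s t, p.IsPath → ∀ u ∈ p.support, u ∈ A

theorem IsPathConvex.inter {A B : Set ι} (hA : IsPathConvex T A) (hB : IsPathConvex T B) :
    IsPathConvex T (A ∩ B) :=
  fun _ hs _ ht p hp u hu => ⟨hA hs.1 ht.1 p hp u hu, hB hs.2 ht.2 p hp u hu⟩

theorem SimpleGraph.Walk.exists_first_mem {S : Set ι} {c a : ι} (q : T.Walk c a) (ha : a ∈ S) :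
    ∃ m ∈ S, ∃ (q₁ : T.Walk c m) (q₂ : T.Walk m a), q = q₁.append q₂ ∧
      ∀ x ∈ q₁.support, x ∈ S → x = m := by
  induction q with
  | nil => exact ⟨_, ha, .nil, .nil, rfl, by simp⟩
  | @cons c d a hadj q ih =>
    by_cases hc : c ∈ S
    · exact ⟨c, hc, .nil, .cons hadj q, rfl, by simp⟩
    · obtain ⟨m, hm, q₁, q₂, rfl, h⟩ := ih ha
      refine ⟨m, hm, .cons hadj q₁, q₂, rfl, ?_⟩
      simp only [Walk.support_cons, List.mem_cons, forall_eq_or_imp]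
      exact ⟨fun h => absurd h hc, h⟩

theorem IsPathConvex.inter₃_nonempty (hT : T.Connected) {A B C : Set ι} (hA : IsPathConvex T A)
    (hB : IsPathConvex T B) (hC : IsPathConvex T C) (hAB : (A ∩ B).Nonempty)
    (hBC : (B ∩ C).Nonempty) (hAC : (A ∩ C).Nonempty) : (A ∩ B ∩ C).Nonempty := by
  classical
  obtain ⟨a, haA, haB⟩ := hAB
  obtain ⟨b, hbB, hbC⟩ := hBC
  obtain ⟨c, hcA, hcC⟩ := hAC
  obtain ⟨p, hp⟩ := hT.exists_isPath a b
  obtain ⟨q, hq⟩ := hT.exists_isPath c a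
  obtain ⟨m, hm, q₁, q₂, rfl, hfirst⟩ :=
    q.exists_first_mem (S := {x | x ∈ p.support}) p.start_mem_support
  have hm' : m ∈ p.support := hm
  refine ⟨m, ⟨hA hcA haA _ hq m (by simp), hB haB hbB p hp m hm⟩, ?_⟩
  have hpath : (q₁.append (p.dropUntil m hm)).IsPath := by
    rw [Walk.isPath_def, Walk.support_append, List.nodup_append']
    have hd := hp.dropUntil hm'
    refine ⟨hq.of_append_left.support_nodup, hd.support_nodup.tail, fun x hx hx' => ?_⟩
    obtain rfl := hfirst x hx (p.support_dropUntil_subset_support hm' (List.mem_of_mem_tail hx'))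
    have := hd.support_nodup
    rw [← Walk.cons_tail_support] at this
    exact (List.nodup_cons.1 this).1 hx'
  exact hC hcC hbC _ hpath m (by simp)

/-- Helly property of subtrees: finitely many pairwise intersecting subtrees share a node. -/
theorem IsPathConvex.helly (hT : T.Connected) {α : Type*} (s : Finset α) :
    ∀ F : α → Set ι, (∀ i ∈ s, IsPathConvex T (F i)) →
      (∀ i ∈ s, ∀ j ∈ s, (F i ∩ F j).Nonempty) → ∃ t, ∀ i ∈ s, t ∈ F i := by
  classical
  induction s using Finset.induction_on with
  | empty =>
    intro F _ _
    have := hT.nonempty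
    exact ⟨Classical.arbitrary ι, by simp⟩
  | insert a s has ih =>
    intro F hF hne
    rcases s.eq_empty_or_nonempty with rfl | ⟨b, hb⟩
    · obtain ⟨t, ht, -⟩ := hne a (by simp) a (by simp)
      exact ⟨t, by simpa using ht⟩
    · have hFa := hF a (by simp)
      have hF' : ∀ i ∈ s, IsPathConvex T (F i) := fun i hi => hF i (Finset.mem_insert_of_mem hi)
      obtain ⟨t, ht⟩ := ih (fun i => F i ∩ F a) (fun i hi => (hF' i hi).inter hFa) <| by
        intro i hi j hj
        obtain ⟨x, ⟨hx1, hx2⟩, hx3⟩ := (hF' i hi).inter₃_nonempty hT (hF' j hj) hFa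
          (hne i (by simp [hi]) j (by simp [hj])) (hne j (by simp [hj]) a (by simp))
          (hne i (by simp [hi]) a (by simp))
        exact ⟨x, ⟨hx1, hx3⟩, hx2, hx3⟩
      refine ⟨t, ?_⟩
      simp only [Finset.mem_insert, forall_eq_or_imp]
      exact ⟨(ht b hb).2, fun i hi => (ht i hi).1⟩

theorem SimpleGraph.IsAcyclic.support_subset (hT : T.IsAcyclic) {s t : ι} {p : T.Walk s t}
    (hp : p.IsPath) (q : T.Walk s t) : p.support ⊆ q.support := by
  classical
  have h2 : p = q.bypass :=
    congrArg Subtype.val ((hT.subsingleton_path s t).elim ⟨p, hp⟩ q.toPath)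
  rw [h2]
  exact q.support_bypass_subset_support

end Tree

section TreeDecomp

variable {V ι : Type u} {G : SimpleGraph V} {T : SimpleGraph ι}

/-- The nodes whose bags meet a connected set form a subtree. -/
theorem TreeDecomp.isPathConvex (td : TreeDecomp G T) {S : Set V} (hS : IsConnSet G S) :
    IsPathConvex T {t | (td.bag t ∩ S).Nonempty} := by
  rintro s ⟨x, hxs, hx⟩ t ⟨y, hyt, hy⟩ p hp u hu
  obtain ⟨w, hw⟩ := hS.2 x hx y hy
  clear hx hy
  induction w generalizing s with
  | nil => exact ⟨_, td.bag_sep p hp u hu ⟨hxs, hyt⟩, hw _ (by simp)⟩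
  | cons hadj w ih =>
    obtain ⟨r, hxr, hyr⟩ := td.exists_bag_adj hadj
    obtain ⟨p₁, hp₁⟩ := td.isTree.connected.exists_isPath s r
    obtain ⟨p₂, hp₂⟩ := td.isTree.connected.exists_isPath r t
    simp only [Walk.support_cons, List.mem_cons, forall_eq_or_imp] at hw
    have := td.isTree.isAcyclic.support_subset hp (p₁.append p₂) hu
    rw [Walk.mem_support_append_iff] at this
    rcases this with h | h
    · exact ⟨_, td.bag_sep p₁ hp₁ u h ⟨hxs, hxr⟩, hw.1⟩
    · exact ih hyr hyt p₂ hp₂ h hw.2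

/-- Every bramble is covered by some bag of any tree-decomposition. -/
theorem IsBramble.exists_bag_cover [Finite V] {B : Set (Set V)} (hB : IsBramble G B)
    (td : TreeDecomp G T) : ∃ t, ∀ S ∈ B, (td.bag t ∩ S).Nonempty := by
  have hfin : B.Finite := Set.toFinite B
  obtain ⟨t, ht⟩ := IsPathConvex.helly td.isTree.connected hfin.toFinset
    (fun S => {t | (td.bag t ∩ S).Nonempty})
    (fun S hS => td.isPathConvex (hB.1 S (hfin.mem_toFinset.1 hS))) <| by
      intro S hS S' hS'
      rw [hfin.mem_toFinset] at hS hS'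
      obtain ⟨a, ha, b, hb, hab⟩ := (hB.2 S hS S' hS').exists_touch (hB.1 S hS).1 (hB.1 S' hS').1
      rcases hab with rfl | hab
      · obtain ⟨t, ht⟩ := td.exists_bag a
        exact ⟨t, ⟨a, ht, ha⟩, ⟨a, ht, hb⟩⟩
      · obtain ⟨t, ht, ht'⟩ := td.exists_bag_adj hab
        exact ⟨t, ⟨a, ht, ha⟩, ⟨b, ht', hb⟩⟩
  exact ⟨t, fun S hS => ht S (hfin.mem_toFinset.2 hS)⟩

theorem exists_treeDecomp_ncard_le [Finite V] (G : SimpleGraph V) :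
    ∃ (ι : Type u) (T : SimpleGraph ι) (td : TreeDecomp G T),
      ∀ t, (td.bag t).ncard ≤ treewidth G + 1 := by
  refine Nat.sInf_mem (s := {k | ∃ (ι : Type u) (T : SimpleGraph ι) (td : TreeDecomp G T),
    ∀ t, (td.bag t).ncard ≤ k + 1}) ⟨Nat.card V, PUnit, ⊥, ⟨?_, fun _ => Set.univ, ?_, ?_, ?_⟩, ?_⟩
  · exact IsTree.of_subsingleton
  · simp
  · simp
  · simp
  · intro t
    simp [Set.ncard_univ]

end TreeDecomp

section Cluster

variable {V : Type u} {G : SimpleGraph V} {X : Set V} {h : ℕ} {x y z : V}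

/-- `y` and `z` lie in `X` and are joined by a walk of length at most `h`. -/
def StepIn (G : SimpleGraph V) (X : Set V) (h : ℕ) (y z : V) : Prop :=
  y ∈ X ∧ z ∈ X ∧ ∃ p : G.Walk y z, p.length ≤ h

/-- The vertices of `X` reachable from `x` by jumps of length at most `h` inside `X`. -/
def cluster (G : SimpleGraph V) (X : Set V) (h : ℕ) (x : V) : Set V :=
  {y | Relation.ReflTransGen (StepIn G X h) x y}

theorem StepIn.symm (hs : StepIn G X h y z) : StepIn G X h z y := by
  obtain ⟨hy, hz, p, hp⟩ := hs
  exact ⟨hz, hy, p.reverse, by simpa using hp⟩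

theorem self_mem_cluster : x ∈ cluster G X h x := Relation.ReflTransGen.refl

theorem cluster_subset (hx : x ∈ X) : cluster G X h x ⊆ X := by
  intro y hy
  induction hy with
  | refl => exact hx
  | tail _ hs _ => exact hs.2.1

theorem mem_cluster_of_walk (hx : x ∈ X) (hy : y ∈ cluster G X h x) (hz : z ∈ X)
    (p : G.Walk y z) (hp : p.length ≤ h) : z ∈ cluster G X h x :=
  Relation.ReflTransGen.tail hy ⟨cluster_subset hx hy, hz, p, hp⟩

theorem mem_cluster_symm (hy : y ∈ cluster G X h x) : x ∈ cluster G X h y := by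
  induction hy with
  | refl => exact .refl
  | tail _ hs ih => exact .head hs.symm ih

/-- A cluster with `n` vertices lies in a connected set with at most `(n - 1) * h + 1` vertices. -/
theorem exists_isConnSet_cluster_subset [Finite V] (hx : x ∈ X) :
    ∃ Y, cluster G X h x ⊆ Y ∧ IsConnSet G Y ∧ Y.ncard ≤ (X.ncard - 1) * h + 1 := by
  classical
  have key : ∀ m, m + 1 ≤ (cluster G X h x).ncard → ∃ A ⊆ cluster G X h x, ∃ Y, x ∈ A ∧ A ⊆ Y ∧
      A.ncard = m + 1 ∧ IsConnSet G Y ∧ Y.ncard ≤ m * h + 1 := by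
    intro m
    induction m with
    | zero =>
      intro _
      exact ⟨{x}, by simpa using self_mem_cluster, {x}, rfl, subset_rfl, by simp,
        IsConnSet.singleton x, by simp⟩
    | succ m ih =>
      intro hm
      obtain ⟨A, hA, Y, hxA, hAY, hcard, hY, hYcard⟩ := ih (by omega)
      obtain ⟨a, ha, b, hb, hab⟩ : ∃ a ∈ A, ∃ b, b ∉ A ∧ StepIn G X h a b := by
        by_contra! hcon
        have : cluster G X h x ⊆ A := by
          intro y hy
          induction hy with
          | refl => exact hxA
          | tail _ hs ih => exact by_contra fun hbA => hcon _ ih _ hbA hs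
        have := Set.ncard_le_ncard this (Set.toFinite _)
        omega
      obtain ⟨-, hbX, p, hp⟩ := hab
      have hbK : b ∈ cluster G X h x := mem_cluster_of_walk hx (hA ha) hbX p hp
      have hpc : IsConnSet G {v | v ∈ p.support} := by
        have h1 : ∀ v ∈ p.support, ConnIn G {v | v ∈ p.support} a v := fun v hv =>
          ⟨p.takeUntil v hv, fun w hw => p.support_takeUntil_subset_support hv hw⟩
        exact ⟨⟨a, p.start_mem_support⟩, fun v hv w hw => (h1 v hv).symm.trans (h1 w hw)⟩
      refine ⟨insert b A, Set.insert_subset hbK hA, Y ∪ {v | v ∈ p.support}, .inr hxA,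
        Set.insert_subset (.inr p.end_mem_support) (hAY.trans Set.subset_union_left), ?_,
        hY.union hpc (hAY ha) p.start_mem_support (.inl rfl), ?_⟩
      · rw [Set.ncard_insert_of_notMem hb, hcard]
      · have hsub : Y ∪ {v | v ∈ p.support} ⊆ Y ∪ (p.support.tail.toFinset : Set V) := by
          rintro v (hv | hv)
          · exact .inl hv
          · have hv : v ∈ p.support := hv
            rw [Walk.mem_support_iff] at hv
            rcases hv with rfl | hv
            · exact .inl (hAY ha)
            · exact .inr (by simpa using hv)
        have h1 := Set.ncard_le_ncard hsub (Set.toFinite _)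
        have h2 := Set.ncard_union_le Y (p.support.tail.toFinset : Set V)
        rw [Set.ncard_coe_finset] at h2
        have h3 := List.toFinset_card_le p.support.tail
        have h4 : p.support.tail.length = p.length := by simp
        rw [Nat.add_mul, Nat.one_mul]
        omega
  have hpos : 0 < (cluster G X h x).ncard :=
    (Set.ncard_pos (Set.toFinite _)).2 ⟨x, self_mem_cluster⟩
  obtain ⟨A, hA, Y, -, hAY, hcard, hY, hYcard⟩ := key ((cluster G X h x).ncard - 1) (by omega)
  have hAK : A = cluster G X h x := Set.eq_of_subset_of_ncard_le hA (by omega) (Set.toFinite _)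
  refine ⟨Y, hAK ▸ hAY, hY, hYcard.trans ?_⟩
  have := Set.ncard_le_ncard (cluster_subset (G := G) (h := h) hx) (Set.toFinite _)
  gcongr

end Cluster

section Weight

variable {V : Type u} {G : SimpleGraph V}

/-- The sum of an edge weight along a walk. -/
def walkWeight (φ : Sym2 V → ZMod 2) {x y : V} (p : G.Walk x y) : ZMod 2 :=
  (p.edges.map φ).sum

variable {φ : Sym2 V → ZMod 2} {x y z : V}

@[simp]
theorem walkWeight_nil : walkWeight φ (Walk.nil : G.Walk x x) = 0 := rfl

@[simp]
theorem walkWeight_cons (hadj : G.Adj x y) (p : G.Walk y z) :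
    walkWeight φ (Walk.cons hadj p) = φ s(x, y) + walkWeight φ p := by
  simp [walkWeight]

@[simp]
theorem walkWeight_append (p : G.Walk x y) (q : G.Walk y z) :
    walkWeight φ (p.append q) = walkWeight φ p + walkWeight φ q := by
  simp [walkWeight]

/-- The weight of a walk along which `φ` is the coboundary of `f`. -/
theorem walkWeight_eq_add {f : V → ZMod 2} (p : G.Walk x y)
    (hf : ∀ a ∈ p.support, ∀ b ∈ p.support, G.Adj a b → φ s(a, b) = f a + f b) :
    walkWeight φ p = f x + f y := by
  induction p with
  | nil => simp [CharTwo.add_self_eq_zero]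
  | @cons a b c hadj p ih =>
    rw [walkWeight_cons, hf a (by simp) b (by simp) hadj,
      ih fun u hu v hv => hf u (by simp [hu]) v (by simp [hv])]
    linear_combination CharTwo.add_self_eq_zero (f b)

theorem SimpleGraph.Walk.IsPath.walkWeight_of_mem_edges {p : G.Walk x y} (hp : p.IsPath)
    (he : s(x, y) ∈ p.edges) : walkWeight φ p = φ s(x, y) := by
  cases p with
  | nil => simp at he
  | @cons _ v _ hadj q =>
    rw [Walk.cons_isPath_iff] at hp
    rw [Walk.edges_cons, List.mem_cons] at he
    rcases he with he | he
    · obtain rfl : y = v := by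
        rcases Sym2.eq_iff.1 he with ⟨-, h⟩ | ⟨h, h'⟩
        · exact h
        · exact h'.trans h
      rw [(Walk.isPath_iff_nil.1 hp.1).eq_nil]
      simp
    · exact absurd (q.fst_mem_support_of_mem_edges he) hp.2

theorem walkWeight_bypass [DecidableEq V]
    (hφ : ∀ ⦃v : V⦄ (p : G.Walk v v), p.IsCycle → walkWeight φ p = 0) (p : G.Walk x y) :
    walkWeight φ p.bypass = walkWeight φ p := by
  induction p with
  | nil => rfl
  | @cons a b c hadj p ih =>
    rw [Walk.bypass]
    split_ifs with hs
    · have hsplit := congrArg (walkWeight φ) (p.bypass.take_spec hs)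
      rw [walkWeight_append, ih] at hsplit
      rw [walkWeight_cons, ← hsplit]
      have hpath := p.bypass_isPath.takeUntil hs
      suffices φ s(a, b) + walkWeight φ (p.bypass.takeUntil a hs) = 0 by
        linear_combination -this
      by_cases he : s(a, b) ∈ (p.bypass.takeUntil a hs).edges
      · rw [Sym2.eq_swap] at he ⊢
        rw [hpath.walkWeight_of_mem_edges he, CharTwo.add_self_eq_zero]
      · exact hφ _ ((Walk.cons_isCycle_iff _ hadj).2 ⟨hpath, he⟩)
    · rw [walkWeight_cons, walkWeight_cons, ih]

theorem walkWeight_eq_zero (hφ : ∀ ⦃v : V⦄ (p : G.Walk v v), p.IsCycle → walkWeight φ p = 0)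
    (p : G.Walk x x) : walkWeight φ p = 0 := by
  classical
  rw [← walkWeight_bypass hφ, (Walk.isPath_iff_nil.1 p.bypass_isPath).eq_nil, walkWeight_nil]

/-- A weight vanishing on all cycles is a coboundary. -/
theorem exists_potential (hφ : ∀ ⦃v : V⦄ (p : G.Walk v v), p.IsCycle → walkWeight φ p = 0) :
    ∃ f : V → ZMod 2, ∀ a b, G.Adj a b → φ s(a, b) = f a + f b := by
  have hroot : ∀ v, Nonempty (G.Walk (G.connectedComponentMk v).out v) := fun v =>
    ConnectedComponent.exact (Quot.out_eq (G.connectedComponentMk v))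
  refine ⟨fun v => walkWeight φ (hroot v).some, fun a b hab => ?_⟩
  have hroots : (G.connectedComponentMk a).out = (G.connectedComponentMk b).out :=
    congrArg _ (ConnectedComponent.sound hab.reachable)
  have := walkWeight_eq_zero hφ
    ((((hroot a).some.append hab.toWalk).append (hroot b).some.reverse).copy rfl hroots.symm)
  have h1 : walkWeight φ (hroot a).some + φ s(a, b) + walkWeight φ (hroot b).some = 0 := by
    rw [← this]
    simp [walkWeight, add_assoc]
  linear_combination h1 - CharTwo.add_self_eq_zero (walkWeight φ (hroot a).some)
    - CharTwo.add_self_eq_zero (walkWeight φ (hroot b).some)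

theorem sum_walkChar_mul [Fintype (Sym2 V)] {p : G.Walk x x} (hp : p.IsCycle) :
    ∑ e, walkChar p e * φ e = walkWeight φ p := by
  classical
  rw [walkWeight, ← List.sum_toFinset _ hp.edges_nodup]
  simp only [walkChar, ite_mul, one_mul, zero_mul]
  rw [← Finset.sum_filter]
  congr 1
  ext e
  simp

/-- A weight vanishing on a generating set of cycles vanishes on all cycles. -/
theorem GeneratesLE.walkWeight_eq_zero [Finite V] {ℓ : ℕ} (hℓ : GeneratesLE G ℓ)
    (hφ : ∀ ⦃v : V⦄ (p : G.Walk v v), p.IsCycle → p.length ≤ ℓ → walkWeight φ p = 0)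
    ⦃v : V⦄ (p : G.Walk v v) (hp : p.IsCycle) : walkWeight φ p = 0 := by
  have := Fintype.ofFinite (Sym2 V)
  rw [← sum_walkChar_mul hp]
  refine Submodule.span_induction (p := fun g _ => ∑ e, g e * φ e = 0) ?_ ?_ ?_ ?_ (hℓ p hp)
  · rintro _ ⟨v, q, hq, hlen, rfl⟩
    rw [sum_walkChar_mul hq, hφ q hq hlen]
  · simp
  · intro f g _ _ hf hg
    simp [add_mul, Finset.sum_add_distrib, hf, hg]
  · intro c f _ hf
    simp [mul_assoc, ← Finset.mul_sum, hf]

end Weight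

section Cut

variable {V : Type u} {G : SimpleGraph V} {X U : Set V} {x : V} {ℓ : ℕ}

/-- A short cycle cannot meet both a cluster and the rest of `X`. -/
theorem SimpleGraph.Walk.disjoint_or_of_length_le {v : V} (p : G.Walk v v) (hp : p.length ≤ ℓ)
    (hx : x ∈ X) :
    (∀ a ∈ p.support, a ∉ cluster G X (ℓ / 2) x) ∨
      ∀ a ∈ p.support, a ∈ X → a ∈ cluster G X (ℓ / 2) x := by
  classical
  by_contra! hcon
  obtain ⟨⟨a, ha, haK⟩, b, hb, hbX, hbK⟩ := hcon
  have hb' : b ∈ (p.rotate a ha).support := by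
    rwa [Walk.mem_support_rotate_iff]
  have hlen := congrArg Walk.length ((p.rotate a ha).take_spec hb')
  rw [Walk.length_append, Walk.length_rotate] at hlen
  rcases le_total ((p.rotate a ha).takeUntil b hb').length
    ((p.rotate a ha).dropUntil b hb').length with hle | hle
  · exact hbK (mem_cluster_of_walk hx haK hbX ((p.rotate a ha).takeUntil b hb') (by omega))
  · exact hbK (mem_cluster_of_walk hx haK hbX ((p.rotate a ha).dropUntil b hb').reverse
      (by rw [Walk.length_reverse]; omega))

/-- If cycles of length at most `ℓ` generate the cycle space, the edges between an `ℓ / 2`-cluster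
of `X` and a component `U` of `G - X` form a cut. -/
theorem GeneratesLE.exists_cut [Finite V] (hℓ : GeneratesLE G ℓ) (hx : x ∈ X)
    (hU : IsConnSet G U) (hUX : Disjoint U X) (hout : ∀ a ∈ U, ∀ b, b ∉ U → G.Adj a b → b ∈ X)
    {k u : V} (hk : k ∈ cluster G X (ℓ / 2) x) (hu : u ∈ U) (huk : G.Adj u k) :
    ∃ L, cluster G X (ℓ / 2) x ⊆ L ∧ Disjoint U L ∧
      ∀ a ∈ L, ∀ b, b ∉ L → G.Adj a b → a ∈ cluster G X (ℓ / 2) x ∧ b ∈ U := by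
  classical
  set K := cluster G X (ℓ / 2) x with hKdef
  have hKX : K ⊆ X := cluster_subset hx
  have hKU : ∀ a ∈ K, a ∉ U := fun a ha haU => Set.disjoint_left.1 hUX haU (hKX ha)
  let φ : Sym2 V → ZMod 2 := fun e => if ∃ a ∈ K, ∃ b ∈ U, e = s(a, b) then 1 else 0
  have hφ : ∀ a b, φ s(a, b) = if (a ∈ K ∧ b ∈ U) ∨ (a ∈ U ∧ b ∈ K) then 1 else 0 := by
    intro a b
    refine if_congr ⟨?_, ?_⟩ rfl rfl
    · rintro ⟨c, hc, d, hd, he⟩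
      rcases Sym2.eq_iff.1 he with ⟨rfl, rfl⟩ | ⟨rfl, rfl⟩
      · exact .inl ⟨hc, hd⟩
      · exact .inr ⟨hd, hc⟩
    · rintro (⟨ha, hb⟩ | ⟨ha, hb⟩)
      · exact ⟨a, ha, b, hb, rfl⟩
      · exact ⟨b, hb, a, ha, Sym2.eq_swap⟩
  let g : V → ZMod 2 := fun v => if v ∈ U then 1 else 0
  have hg : ∀ a b, G.Adj a b → (a ∈ X → a ∈ K) → (b ∈ X → b ∈ K) → φ s(a, b) = g a + g b := by
    intro a b hab ha hb
    rw [hφ]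
    by_cases haU : a ∈ U <;> by_cases hbU : b ∈ U
    · simp [g, haU, hbU, CharTwo.add_self_eq_zero,
        show a ∉ K from fun h => hKU a h haU, show b ∉ K from fun h => hKU b h hbU]
    · simp [g, haU, hbU, hb (hout a haU b hbU hab)]
    · simp [g, haU, hbU, ha (hout b hbU a haU hab.symm)]
    · simp [g, haU, hbU]
  obtain ⟨f, hf⟩ := exists_potential (φ := φ) <| hℓ.walkWeight_eq_zero <| by
    intro v p _ hlen
    rcases p.disjoint_or_of_length_le hlen hx with h | h
    · rw [walkWeight_eq_add (f := 0) p]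
      · simp
      · intro a ha b hb _
        simp [hφ, hKdef, h a ha, h b hb]
    · rw [walkWeight_eq_add (f := g) p fun a ha b hb hab => hg a b hab (h a ha) (h b hb),
        CharTwo.add_self_eq_zero]
  have hfK : ∀ a ∈ K, f a = f x := by
    intro a ha
    induction ha with
    | refl => rfl
    | @tail b c hb hs ih =>
      rw [← ih]
      obtain ⟨-, hcX, p, hp⟩ := hs
      have hcK : c ∈ K := mem_cluster_of_walk hx hb hcX p hp
      have h1 := walkWeight_eq_add (f := f) (φ := φ) p fun a _ b _ hab => hf a b hab
      rw [walkWeight_eq_add (f := g) p fun a ha d hd had => hg a d had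
        (fun h => mem_cluster_of_walk hx hb h (p.takeUntil a ha)
          ((p.length_takeUntil_le_length ha).trans hp))
        (fun h => mem_cluster_of_walk hx hb h (p.takeUntil d hd)
          ((p.length_takeUntil_le_length hd).trans hp))] at h1
      simp only [g, hKU b hb, hKU c hcK, if_false, add_zero] at h1
      linear_combination CharTwo.add_self_eq_zero (f c) + h1
  have hne : f u ≠ f x := by
    intro h
    have := hf u k huk
    rw [hφ, if_pos (.inr ⟨hu, hk⟩), hfK k hk, h, CharTwo.add_self_eq_zero] at this
    exact one_ne_zero this
  refine ⟨{v | f v = f x}, hfK, Set.disjoint_left.2 fun v hv hvL => ?_, ?_⟩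
  · refine hne ((hU.2 v hv u hu).induction (P := fun v => f v = f x) hvL ?_)
    intro a ha b hb hab hax
    have := hf a b hab
    rw [hφ, if_neg (by rintro (⟨h, -⟩ | ⟨-, h⟩); exacts [hKU a h ha, hKU b h hb])] at this
    rw [← hax]
    linear_combination CharTwo.add_self_eq_zero (f b) + this
  · intro a ha b hb hab
    have h1 := hf a b hab
    rw [hφ] at h1
    split_ifs at h1 with hcase
    · rcases hcase with h | h
      · exact h
      · exact absurd (hfK b h.2) hb
    · refine absurd ?_ hb
      have ha : f a = f x := ha
      show f b = f x
      rw [← ha]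
      linear_combination CharTwo.add_self_eq_zero (f b) + h1

end Cut

section Bramble

variable {V : Type u} {G : SimpleGraph V} {B : Set (Set V)}

/-- The vertices joined in `G - K` to an element of `B` avoiding `K`. -/
def bigSide (G : SimpleGraph V) (B : Set (Set V)) (K : Set V) : Set V :=
  {y | ∃ S ∈ B, Disjoint S K ∧ ∃ s ∈ S, ConnIn G Kᶜ s y}

variable {K : Set V}

theorem subset_bigSide {S : Set V} (hS : S ∈ B) (hSK : Disjoint S K) : S ⊆ bigSide G B K :=
  fun s hs => ⟨S, hS, hSK, s, hs, .of_mem (Set.disjoint_left.1 hSK hs)⟩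

theorem disjoint_bigSide : Disjoint (bigSide G B K) K := by
  refine Set.disjoint_left.2 ?_
  rintro y ⟨S, hS, hSK, s, hs, hc⟩
  exact hc.mem_right

theorem mem_bigSide_of_connIn {y z : V} (hy : y ∈ bigSide G B K) (h : ConnIn G Kᶜ y z) :
    z ∈ bigSide G B K := by
  obtain ⟨S, hS, hSK, s, hs, hc⟩ := hy
  exact ⟨S, hS, hSK, s, hs, hc.trans h⟩

theorem IsBramble.connIn_of_mem_bigSide (hB : IsBramble G B) {y z : V} (hy : y ∈ bigSide G B K)
    (hz : z ∈ bigSide G B K) : ConnIn G Kᶜ y z := by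
  obtain ⟨S, hS, hSK, s, hs, hc⟩ := hy
  obtain ⟨S', hS', hSK', s', hs', hc'⟩ := hz
  have := ((hB.2 S hS S' hS').2 s (.inl hs) s' (.inr hs')).mono
    (Set.union_subset hSK.subset_compl_right hSK'.subset_compl_right)
  exact hc.symm.trans (this.trans hc')

/-- Every bramble extends to a maximal one: each connected set outside it fails to touch some
element. -/
theorem IsBramble.exists_maximal [Finite V] (hB : IsBramble G B) : ∃ B', B ⊆ B' ∧ IsBramble G B' ∧
    ∀ U, IsConnSet G U → U ∉ B' → ∃ S ∈ B', ∀ a ∈ U, ∀ b ∈ S, a ≠ b ∧ ¬ G.Adj a b := by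
  obtain ⟨B', hBB', hmax⟩ := Finite.exists_le_maximal (p := IsBramble G) hB
  refine ⟨B', hBB', hmax.1, fun U hU hUB => ?_⟩
  by_contra! hcon
  have key : ∀ S ∈ B', IsConnSet G (U ∪ S) := by
    intro S hS
    obtain ⟨a, ha, b, hb, hab⟩ := hcon S hS
    exact hU.union (hmax.1.1 S hS) ha hb (or_iff_not_imp_left.2 hab)
  refine hUB (hmax.2 (y := insert U B') ⟨?_, ?_⟩ (Set.subset_insert _ _) (Set.mem_insert _ _))
  · rintro S (rfl | hS)
    exacts [hU, hmax.1.1 S hS]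
  · rintro S (rfl | hS) S' (rfl | hS')
    · rwa [Set.union_self]
    · exact key S' hS'
    · rw [Set.union_comm]
      exact key S hS
    · exact hmax.1.2 S hS S' hS'

/-- If `X` covers a maximal bramble, then some `ℓ / 2`-cluster of `X` already covers it. -/
theorem IsBramble.exists_cluster_cover [Finite V] (hB : IsBramble G B) (hne : B.Nonempty)
    (hmax : ∀ U, IsConnSet G U → U ∉ B → ∃ S ∈ B, ∀ a ∈ U, ∀ b ∈ S, a ≠ b ∧ ¬ G.Adj a b)
    {ℓ : ℕ} (hℓ : GeneratesLE G ℓ) (hℓ2 : 2 ≤ ℓ) {X : Set V} (hX : ∀ S ∈ B, (X ∩ S).Nonempty)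
    (hreach : ∀ x ∈ X, ∀ y ∈ X, G.Reachable x y) :
    ∃ x ∈ X, ∀ S ∈ B, (cluster G X (ℓ / 2) x ∩ S).Nonempty := by
  by_contra! hcon
  set C : V → Set V := fun x => bigSide G B (cluster G X (ℓ / 2) x)
  have havoid : ∀ x ∈ X, ∃ S ∈ B, Disjoint S (cluster G X (ℓ / 2) x) := fun x hx => by
    obtain ⟨S, hS, h⟩ := hcon x hx
    exact ⟨S, hS, (Set.disjoint_iff_inter_eq_empty.2 h).symm⟩
  obtain ⟨x, hx, hmin⟩ : ∃ x ∈ X, ∀ y ∈ X, (C x).ncard ≤ (C y).ncard := by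
    obtain ⟨S, hS⟩ := hne
    obtain ⟨y, hy, -⟩ := hX S hS
    exact Set.exists_min_image X (fun x => (C x).ncard) (Set.toFinite X) ⟨y, hy⟩
  set K := cluster G X (ℓ / 2) x
  have hKX : K ⊆ X := cluster_subset hx
  obtain ⟨S₁, hS₁, hS₁K⟩ := havoid x hx
  have hS₁C : S₁ ⊆ C x := subset_bigSide hS₁ hS₁K
  -- an edge from the big side of `K` to `K`
  obtain ⟨u, huC, k, hk, huk⟩ : ∃ u ∈ C x, ∃ k ∈ K, G.Adj u k := by
    obtain ⟨s, hsX, hs⟩ := hX S₁ hS₁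
    obtain ⟨p⟩ := hreach s hsX x hx
    obtain ⟨d, -, hd, hd'⟩ := p.exists_boundary_dart (C x) (hS₁C hs)
      fun h => Set.disjoint_left.1 disjoint_bigSide h self_mem_cluster
    refine ⟨d.fst, hd, d.snd, by_contra fun h => hd' ?_, d.adj⟩
    exact mem_bigSide_of_connIn hd
      (.of_adj d.adj (Set.disjoint_left.1 disjoint_bigSide hd) h)
  have huX : u ∉ X := fun huX => Set.disjoint_left.1 disjoint_bigSide huC <|
    mem_cluster_of_walk hx hk huX huk.symm.toWalk (by simp; omega)
  -- the component `U` of `G - X` containing `u`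
  set U : Set V := {y | ConnIn G Xᶜ u y}
  have huU : u ∈ U := .of_mem huX
  have hUconn : IsConnSet G U :=
    ⟨⟨u, huU⟩, fun a ha b hb => (ConnIn.connIn_reach ha).symm.trans (ConnIn.connIn_reach hb)⟩
  have hUX : Disjoint U X := Set.disjoint_left.2 fun a ha => ConnIn.mem_right ha
  have hout : ∀ a ∈ U, ∀ b, b ∉ U → G.Adj a b → b ∈ X := fun a ha b hb hab =>
    by_contra fun hbX => hb (ConnIn.trans ha (.of_adj hab (ConnIn.mem_right ha) hbX))
  have hUB : U ∉ B := fun h => by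
    obtain ⟨y, hyX, hyU⟩ := hX U h
    exact Set.disjoint_left.1 hUX hyU hyX
  obtain ⟨S, hS, hSU⟩ := hmax U hUconn hUB
  obtain ⟨L, hKL, hUL, hL⟩ := hℓ.exists_cut hx hUconn hUX hout hk huU huk
  have hSL : Disjoint S L := by
    rw [Set.disjoint_left]
    intro a ha haL
    have hsub : S ⊆ L := (hB.1 S hS).subset_of_mem ha haL fun a _ b hb hab haL =>
      by_contra fun hbL => (hSU b (hL a haL b hbL hab).2 b hb).1 rfl
    have hCL : ∀ y ∈ C x, y ∉ L := fun y hy =>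
      (hB.connIn_of_mem_bigSide huC hy).induction (P := (· ∉ L)) (Set.disjoint_left.1 hUL huU)
        fun a _ b hb hab haL hbL => hb (hL b hbL a haL hab.symm).1
    obtain ⟨a, ha, b, hb, hab⟩ := (hB.2 S hS S₁ hS₁).exists_touch (hB.1 S hS).1 (hB.1 S₁ hS₁).1
    have hbL := hCL b (hS₁C hb)
    rcases hab with rfl | hab
    · exact hbL (hsub ha)
    · exact (hSU b (hL a (hsub ha) b hbL hab).2 a ha).2 hab.symm
  have hSC : S ⊆ C x := subset_bigSide hS (hSL.mono_right hKL)
  -- the last exit from `U` towards `S` meets another cluster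
  obtain ⟨s, hs⟩ := (hB.1 S hS).1
  obtain ⟨u', hu', w, hwU, huw, hws⟩ :=
    (hB.connIn_of_mem_bigSide huC (hSC hs)).exists_last_exit huU fun h => (hSU s h s hs).1 rfl
  have hwX : w ∈ X := hout u' hu' w hwU huw
  have hwK : w ∉ K := hws.mem_left.1
  set K₂ := cluster G X (ℓ / 2) w
  have hKK₂ : ∀ a ∈ K, a ∉ K₂ := fun a ha ha₂ =>
    hwK (Relation.ReflTransGen.trans ha (mem_cluster_symm ha₂))
  obtain ⟨L₂, hKL₂, hUL₂, hL₂⟩ := hℓ.exists_cut hwX hUconn hUX hout self_mem_cluster hu' huw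
  have hsL₂ : s ∈ L₂ := hws.induction (hKL₂ self_mem_cluster) fun a _ b hb hab ha =>
    by_contra fun hbL => hb.2 (hL₂ a ha b hbL hab).2
  have hSL₂ : S ⊆ L₂ := (hB.1 S hS).subset_of_mem hs hsL₂ fun a _ b hb hab haL =>
    by_contra fun hbL => (hSU b (hL₂ a haL b hbL hab).2 b hb).1 rfl
  obtain ⟨S₂, hS₂, hS₂K⟩ := havoid w hwX
  have hS₂C : S₂ ⊆ C w := subset_bigSide hS₂ hS₂K
  have hCL₂ : C w ⊆ L₂ := by
    obtain ⟨a, ha, b, hb, hab⟩ := (hB.2 S hS S₂ hS₂).exists_touch (hB.1 S hS).1 (hB.1 S₂ hS₂).1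
    have hbL : b ∈ L₂ := by
      rcases hab with rfl | hab
      · exact hSL₂ ha
      · exact by_contra fun hbL => (hSU b (hL₂ a (hSL₂ ha) b hbL hab).2 a ha).2 hab.symm
    exact fun y hy => (hB.connIn_of_mem_bigSide (hS₂C hb) hy).induction hbL
      fun c hc d _ hcd hcL => by_contra fun hdL => hc (hL₂ c hcL d hdL hcd).1
  have hKL₂' : ∀ a ∈ K, a ∉ L₂ := by
    have hkL : k ∉ L₂ := fun h =>
      hKK₂ k hk (hL₂ k h u (Set.disjoint_left.1 hUL₂ huU) huk.symm).1
    have hstep : ∀ a ∈ K, ∀ b, StepIn G X (ℓ / 2) a b → b ∈ L₂ → a ∈ L₂ := by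
      classical
      rintro a ha b ⟨-, hbX, p, hp⟩ hb
      have hc : ConnIn G K₂ᶜ b a := by
        refine ConnIn.symm ⟨p, fun v hv hvK => ?_⟩
        exact hKK₂ v (mem_cluster_of_walk hx ha (cluster_subset hwX hvK) (p.takeUntil v hv)
          ((p.length_takeUntil_le_length hv).trans hp)) hvK
      exact hc.induction hb fun c hc d _ hcd hcL =>
        by_contra fun hdL => hc (hL₂ c hcL d hdL hcd).1
    have hx' : ∀ a ∈ K, a ∈ L₂ → x ∈ L₂ := by
      intro a ha haL
      induction ha with
      | refl => exact haL
      | tail hb hs ih => exact ih (hstep _ hb _ hs haL)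
    have hfrom : ∀ a ∈ K, x ∈ L₂ → a ∈ L₂ := by
      intro a ha hxL
      induction ha with
      | refl => exact hxL
      | tail hb hs ih => exact hstep _ (Relation.ReflTransGen.tail hb hs) _ hs.symm ih
    exact fun a ha haL => hkL (hfrom k hk (hx' a ha haL))
  have hCC : C w ⊆ C x := by
    rintro y ⟨S', hS', hS'K, s', hs', hc⟩
    have hsub : S' ⊆ C w := subset_bigSide hS' hS'K
    have hCK : C w ⊆ Kᶜ := fun a ha haK => hKL₂' a haK (hCL₂ ha)
    refine ⟨S', hS', Set.disjoint_left.2 fun a ha => hCK (hsub ha), s', hs', ?_⟩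
    exact hc.connIn_reach.mono fun a ha => hCK (mem_bigSide_of_connIn (hsub hs') ha)
  have hwC : w ∈ C x := mem_bigSide_of_connIn (hSC hs) (hws.symm.mono Set.sdiff_subset)
  have hwC' : w ∉ C w := fun h => Set.disjoint_left.1 disjoint_bigSide h self_mem_cluster
  have hlt : (C w).ncard < (C x).ncard :=
    Set.ncard_lt_ncard ⟨hCC, fun h => hwC' (h hwC)⟩ (Set.toFinite _)
  exact absurd (hmin w hwX) (not_le.2 hlt)

end Bramble

theorem exists_generatesLE {V : Type u} [Finite V] (G : SimpleGraph V) :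
    GeneratesLE G (ellGraph G) := by
  have := Fintype.ofFinite V
  refine Nat.sInf_mem (s := {ℓ | GeneratesLE G ℓ}) ⟨Fintype.card V, fun v p hp => ?_⟩
  refine Submodule.subset_span ⟨v, p, hp, ?_, rfl⟩
  have := hp.support_nodup.length_le_card
  simpa using this

theorem GeneratesLE.three_le {V : Type u} {G : SimpleGraph V} {ℓ : ℕ} (hℓ : GeneratesLE G ℓ)
    {v : V} {p : G.Walk v v} (hp : p.IsCycle) : 3 ≤ ℓ := by
  by_contra! hlt
  have hempty : cycleChars G ℓ = ∅ := by
    refine Set.eq_empty_of_forall_notMem ?_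
    rintro _ ⟨w, q, hq, hlen, -⟩
    have := hq.three_le_length
    omega
  have hmem := hℓ p hp
  rw [hempty, Submodule.span_empty, Submodule.mem_bot] at hmem
  cases p with
  | nil => exact hp.ne_nil rfl
  | @cons _ b _ hadj q => simpa [walkChar] using congrFun hmem s(v, b)

/-- the connected order of any bramble of a graph containing a
cycle is at most `tw(G)·⌊ℓ(G)/2⌋ + 1`. -/
theorem bramble_order_bound {V : Type u} [Finite V] (G : SimpleGraph V)
    (hc : ∃ (v : V) (p : G.Walk v v), p.IsCycle)
    (B : Set (Set V)) (hB : IsBramble G B) :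
    ∃ X, IsConnCover G B X ∧ X.ncard ≤ treewidth G * (ellGraph G / 2) + 1 := by
  classical
  have hℓ := exists_generatesLE G
  obtain ⟨v₀, p₀, hp₀⟩ := hc
  have h3 := hℓ.three_le hp₀
  obtain ⟨B', hBB', hB', hmax⟩ := hB.exists_maximal
  suffices ∃ X, IsConnCover G B' X ∧ X.ncard ≤ treewidth G * (ellGraph G / 2) + 1 by
    obtain ⟨X, hX, hcard⟩ := this
    exact ⟨X, ⟨hX.1, fun S hS => hX.2 S (hBB' hS)⟩, hcard⟩
  rcases B'.eq_empty_or_nonempty with rfl | hne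
  · exact ⟨{v₀}, ⟨IsConnSet.singleton v₀, by simp⟩, by simp⟩
  obtain ⟨ι, T, td, htd⟩ := exists_treeDecomp_ncard_le G
  obtain ⟨t, ht⟩ := hB'.exists_bag_cover td
  obtain ⟨S₀, hS₀⟩ := hne
  obtain ⟨s₀, hs₀⟩ := (hB'.1 S₀ hS₀).1
  set X : Set V := td.bag t ∩ {y | G.Reachable s₀ y}
  have hX : ∀ S ∈ B', (X ∩ S).Nonempty := by
    intro S hS
    obtain ⟨y, hyt, hyS⟩ := ht S hS
    obtain ⟨q, -⟩ := (hB'.2 S₀ hS₀ S hS).2 s₀ (.inl hs₀) y (.inr hyS)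
    exact ⟨y, ⟨hyt, ⟨q⟩⟩, hyS⟩
  obtain ⟨x, hx, hcover⟩ := hB'.exists_cluster_cover ⟨S₀, hS₀⟩ hmax hℓ (by omega) hX
    fun a ha b hb => ha.2.symm.trans hb.2
  obtain ⟨Y, hKY, hY, hYcard⟩ :=
    exists_isConnSet_cluster_subset (G := G) (h := ellGraph G / 2) hx
  refine ⟨Y, ⟨hY, fun S hS => (hcover S hS).mono (Set.inter_subset_inter_left _ hKY)⟩,
    hYcard.trans ?_⟩
  have h1 : X.ncard ≤ (td.bag t).ncard :=
    Set.ncard_le_ncard Set.inter_subset_left (Set.toFinite _)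
  have h2 := htd t
  gcongr
  omega
end

section
/- Let n ≥ 3 and k ≥ 0 be integers, and let G be obtained from the complete graph K_n by subdividing every edge exactly k times. Then tw(G) = n − 1 and ℓ(G) = 3(k + 1), where ℓ(G) is the smallest ℓ such that cycles of length at most ℓ generate the cycle space of G. -/
open SimpleGraph

universe u

namespace SimpleGraph

variable {ι : Type u} {T : SimpleGraph ι}

/-- A vertex set containing every path of `T` between two of its vertices. -/
def IsPathConvex (T : SimpleGraph ι) (S : Set ι) : Prop :=
  ∀ ⦃x y : ι⦄ (p : T.Walk x y), p.IsPath → x ∈ S → y ∈ S → ∀ v ∈ p.support, v ∈ S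

theorem IsPathConvex.inter {A B : Set ι} (hA : IsPathConvex T A) (hB : IsPathConvex T B) :
    IsPathConvex T (A ∩ B) := fun _ _ p hp hx hy v hv =>
  ⟨hA p hp hx.1 hy.1 v hv, hB p hp hx.2 hy.2 v hv⟩

/-- In an acyclic graph, the unique path between two vertices stays in every set containing
some walk between them. -/
theorem IsAcyclic.support_subset_of_connIn (hT : T.IsAcyclic) {S : Set ι} {x y : ι}
    (h : ConnIn T S x y) (p : T.Walk x y) (hp : p.IsPath) : ∀ v ∈ p.support, v ∈ S := by
  classical
  obtain ⟨q, hq⟩ := h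
  have := congrArg Subtype.val ((hT.subsingleton_path x y).elim ⟨p, hp⟩ q.toPath)
  intro v hv
  simp only at this
  rw [this] at hv
  exact hq v (q.support_bypass_subset_support hv)

theorem IsAcyclic.isPathConvex (hT : T.IsAcyclic) {S : Set ι}
    (h : ∀ x ∈ S, ∀ y ∈ S, ConnIn T S x y) : IsPathConvex T S :=
  fun x y p hp hx hy => hT.support_subset_of_connIn (h x hx y hy) p hp

theorem IsTree.exists_mem_inter_of_support_subset_union (hT : T.IsTree) {A C : Set ι}
    (hA : IsPathConvex T A) (hC : IsPathConvex T C) {c : ι} (hc : c ∈ A ∩ C) {a b : ι}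
    (p : T.Walk a b) (ha : a ∈ A) (hb : b ∈ C) (hp : ∀ v ∈ p.support, v ∈ A ∪ C) :
    ∃ v ∈ p.support, v ∈ A ∩ C := by
  induction p with
  | nil => exact ⟨_, by simp, ha, hb⟩
  | @cons a a' b h p ih =>
    by_cases haC : a ∈ C
    · exact ⟨a, by simp, ha, haC⟩
    have ha' : a' ∈ A := by
      rcases hp a' (by simp) with h' | h'
      · exact h'
      obtain ⟨q, hq, -⟩ := hT.existsUnique_path c a
      obtain ⟨q', hq', -⟩ := hT.existsUnique_path c a'
      exact hA q hq hc.1 ha _ (hT.isAcyclic.mem_support_of_ne_mem_support_of_adj_of_isPath hq hq' h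
        fun hmem => haC (hC q' hq' hc.2 h' _ hmem))
    obtain ⟨v, hv, hv'⟩ := ih ha' hb fun v hv => hp v (by simp [hv])
    exact ⟨v, by simp [hv], hv'⟩

theorem IsTree.inter_inter_nonempty (hT : T.IsTree) {A B C : Set ι}
    (hA : IsPathConvex T A) (hB : IsPathConvex T B) (hC : IsPathConvex T C)
    (hAB : (A ∩ B).Nonempty) (hBC : (B ∩ C).Nonempty) (hAC : (A ∩ C).Nonempty) :
    (A ∩ B ∩ C).Nonempty := by
  obtain ⟨a, haA, haB⟩ := hAB
  obtain ⟨b, hbB, hbC⟩ := hBC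
  obtain ⟨c, hcA, hcC⟩ := hAC
  obtain ⟨p, hp, -⟩ := hT.existsUnique_path a b
  obtain ⟨q, hq, -⟩ := hT.existsUnique_path a c
  obtain ⟨q', hq', -⟩ := hT.existsUnique_path c b
  have hsub : ∀ v ∈ p.support, v ∈ A ∪ C := by
    refine hT.isAcyclic.support_subset_of_connIn ⟨q.append q', fun v hv => ?_⟩ p hp
    rcases (Walk.mem_support_append_iff _ _).1 hv with hv | hv
    · exact Or.inl (hA q hq haA hcA v hv)
    · exact Or.inr (hC q' hq' hcC hbC v hv)
  obtain ⟨v, hv, hvA, hvC⟩ :=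
    hT.exists_mem_inter_of_support_subset_union hA hC ⟨hcA, hcC⟩ p haA hbC hsub
  exact ⟨v, ⟨hvA, hB p hp haB hbB v hv⟩, hvC⟩

/-- The Helly property for subtrees of a tree. -/
theorem IsTree.helly (hT : T.IsTree) {α : Type*} (s : Finset α) (hs : s.Nonempty)
    (S : α → Set ι) (hS : ∀ i ∈ s, IsPathConvex T (S i))
    (hmeet : ∀ i ∈ s, ∀ j ∈ s, (S i ∩ S j).Nonempty) : ∃ t, ∀ i ∈ s, t ∈ S i := by
  induction hs using Finset.Nonempty.cons_induction generalizing S with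
  | singleton a =>
    obtain ⟨t, ht⟩ := hmeet a (by simp) a (by simp)
    exact ⟨t, by simpa using ht.1⟩
  | cons a s ha hs ih =>
    simp only [Finset.mem_cons, forall_eq_or_imp] at hS hmeet
    obtain ⟨t, ht⟩ := ih (fun i => S i ∩ S a) (fun i hi => (hS.2 i hi).inter hS.1) (by
      intro i hi j hj
      have := hT.inter_inter_nonempty (hS.2 i hi) hS.1 (hS.2 j hj) (hmeet.2 i hi).1
        (hmeet.1.2 j hj) ((hmeet.2 i hi).2 j hj)
      exact this.mono fun x hx => ⟨hx.1, hx.2, hx.1.2⟩)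
    obtain ⟨i, hi⟩ := hs
    exact ⟨t, by simpa using ⟨(ht i hi).2, fun j hj => (ht j hj).1⟩⟩

/-- The graph in which every vertex `t` is joined to its parent `par t`. -/
def parentGraph (par : ι → ι) : SimpleGraph ι := fromRel fun a b => b = par a

theorem parentGraph_adj_par {par : ι → ι} {t : ι} (h : par t ≠ t) :
    (parentGraph par).Adj t (par t) := by
  simp [parentGraph, h.symm]

/-- A set closed under taking parents, except at the vertex `top`, is connected. -/
theorem parentGraph_connIn {par : ι → ι} (rank : ι → ℕ) {S : Set ι} {top : ι}
    (hrank : ∀ t ∈ S, t ≠ top → rank (par t) < rank t) (hpar : ∀ t ∈ S, t ≠ top → par t ∈ S)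
    {x y : ι} (hx : x ∈ S) (hy : y ∈ S) : ConnIn (parentGraph par) S x y := by
  have key : ∀ m, ∀ t ∈ S, rank t = m → ConnIn (parentGraph par) S t top := by
    intro m
    induction m using Nat.strong_induction_on with
    | _ m ih =>
      rintro t ht rfl
      by_cases h : t = top
      · subst h
        exact ⟨.nil, by simpa using ht⟩
      · have hlt := hrank t ht h
        obtain ⟨q, hq⟩ := ih _ hlt _ (hpar t ht h) rfl
        have hne : par t ≠ t := fun h => by simp [h] at hlt
        exact ⟨.cons (parentGraph_adj_par hne) q, by simpa using ⟨ht, hq⟩⟩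
  obtain ⟨p, hp⟩ := key _ x hx rfl
  obtain ⟨q, hq⟩ := key _ y hy rfl
  refine ⟨p.append q.reverse, fun v hv => ?_⟩
  rcases (Walk.mem_support_append_iff _ _).1 hv with hv | hv
  · exact hp v hv
  · exact hq v (by simpa using hv)

theorem parentGraph_isTree [Finite ι] {par : ι → ι} (rank : ι → ℕ) (r : ι)
    (hr : par r = r) (hrank : ∀ t, t ≠ r → rank (par t) < rank t) : (parentGraph par).IsTree := by
  have hconn : (parentGraph par).Connected := by
    refine (connected_iff _).2 ⟨fun x y => ?_, ⟨r⟩⟩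
    obtain ⟨p, -⟩ := parentGraph_connIn (S := Set.univ) (top := r) rank (fun t _ h => hrank t h)
      (fun _ _ _ => trivial) (Set.mem_univ x) (Set.mem_univ y)
    exact ⟨p⟩
  refine isTree_iff_connected_and_card.2 ⟨hconn, le_antisymm ?_ ?_⟩
  · have hsub : (parentGraph par).edgeSet ⊆ (fun t => s(t, par t)) '' {t | t ≠ r} := by
      intro e
      induction e with
      | _ a b =>
        intro h
        rw [mem_edgeSet, parentGraph, fromRel_adj] at h
        obtain ⟨hne, rfl | rfl⟩ := h
        · exact ⟨a, by rintro rfl; exact hne hr.symm, rfl⟩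
        · exact ⟨b, by rintro rfl; exact hne hr, Sym2.eq_swap⟩
    have h1 := (Set.ncard_le_ncard hsub (Set.toFinite _)).trans
      (Set.ncard_image_le (Set.toFinite _))
    have h2 : ({t | t ≠ r} : Set ι).ncard + 1 = Nat.card ι := by
      have := Set.ncard_add_ncard_compl ({r} : Set ι)
      rw [Set.ncard_singleton] at this
      rw [← this, add_comm]
      rfl
    rw [← h2]
    exact Nat.add_le_add_right h1 1
  · exact hconn.card_vert_le_card_edgeSet_add_one

end SimpleGraph

/-- The tree vertices whose bag meets a given connected vertex set form a subtree. -/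
theorem TreeDecomp.isPathConvex_setOf_meets {V ι : Type u} {G : SimpleGraph V} {T : SimpleGraph ι}
    (td : TreeDecomp G T) {X : Set V} (hX : ∀ x ∈ X, ∀ y ∈ X, ConnIn G X x y) :
    T.IsPathConvex {t | (td.bag t ∩ X).Nonempty} := by
  refine td.isTree.isAcyclic.isPathConvex ?_
  have key : ∀ ⦃x y : V⦄ (p : G.Walk x y), (∀ v ∈ p.support, v ∈ X) → ∀ t t', x ∈ td.bag t →
      y ∈ td.bag t' → ConnIn T {t | (td.bag t ∩ X).Nonempty} t t' := by
    intro x y p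
    have base : ∀ x ∈ X, ∀ t t', x ∈ td.bag t → x ∈ td.bag t' →
        ConnIn T {t | (td.bag t ∩ X).Nonempty} t t' := by
      intro x hx t t' ht ht'
      obtain ⟨q, hq, -⟩ := td.isTree.existsUnique_path t t'
      exact ⟨q, fun s hs => ⟨x, td.bag_sep q hq s hs ⟨ht, ht'⟩, hx⟩⟩
    induction p with
    | nil => exact fun hp t t' ht ht' => base _ (hp _ (by simp)) t t' ht ht'
    | @cons a b c h p ih =>
      intro hp t t' ht ht'
      obtain ⟨s, hs, hs'⟩ := td.exists_bag_adj h
      obtain ⟨q, hq⟩ := base a (hp _ (by simp)) t s ht hs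
      obtain ⟨q', hq'⟩ := ih (fun v hv => hp v (by simp [hv])) s t' hs' ht'
      refine ⟨q.append q', fun v hv => ?_⟩
      rcases (Walk.mem_support_append_iff _ _).1 hv with hv | hv
      exacts [hq v hv, hq' v hv]
  rintro t ⟨x, hxt, hx⟩ t' ⟨y, hyt, hy⟩
  obtain ⟨p, hp⟩ := hX x hx y hy
  exact key p hp t t' hxt hyt

theorem SimpleGraph.Walk.IsPath.mem_support_tail {V : Type u} {G : SimpleGraph V} {x y v : V}
    {p : G.Walk x y} (hp : p.IsPath) (hv : v ∈ p.support.tail) : v ∈ p.support ∧ v ≠ x := by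
  have h := hp.support_nodup
  rw [← p.cons_tail_support, List.nodup_cons] at h
  exact ⟨List.mem_of_mem_tail hv, by rintro rfl; exact h.1 hv⟩

theorem SimpleGraph.Walk.IsCycle.exists_ne_mem_edges {V : Type u} {G : SimpleGraph V} {x : V}
    {p : G.Walk x x} (hp : p.IsCycle) {v a : V} (h : s(v, a) ∈ p.edges) :
    ∃ b, b ≠ a ∧ s(v, b) ∈ p.edges := by
  have h2 := hp.ncard_neighborSet_toSubgraph_eq_two (p.fst_mem_support_of_mem_edges h)
  obtain ⟨b, hb, hba⟩ := Set.exists_ne_of_one_lt_ncard (by rw [h2]; exact one_lt_two) a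
  exact ⟨b, hba, Walk.adj_toSubgraph_iff_mem_edges.1 hb⟩

/-- The sum over `ZMod 2` of the edges of a walk, counted with multiplicity. -/
def edgeSum {V : Type u} [DecidableEq V] {G : SimpleGraph V} {x y : V} (p : G.Walk x y) :
    Sym2 V → ZMod 2 :=
  (p.edges.map fun e => Pi.single e 1).sum

theorem walkChar_eq_edgeSum {V : Type u} [DecidableEq V] {G : SimpleGraph V} {x y : V}
    {p : G.Walk x y} (hp : p.IsTrail) : walkChar p = edgeSum p := by
  have key : ∀ l : List (Sym2 V), l.Nodup → ∀ e,
      (l.map fun e => (Pi.single e 1 : Sym2 V → ZMod 2)).sum e = if e ∈ l then 1 else 0 := by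
    intro l hl e
    induction l with
    | nil => simp
    | cons a l ih =>
      rw [List.nodup_cons] at hl
      rw [List.map_cons, List.sum_cons, Pi.add_apply, ih hl.2, Pi.single_apply]
      by_cases h : e = a
      · subst h; simp [hl.1]
      · simp [h]
  funext e
  rw [edgeSum, key _ hp.edges_nodup, walkChar]
  congr

theorem edgeSum_cons {V : Type u} [DecidableEq V] {G : SimpleGraph V} {x y z : V}
    (h : G.Adj x y) (p : G.Walk y z) :
    edgeSum (Walk.cons h p) = Pi.single s(x, y) 1 + edgeSum p := by
  simp [edgeSum]

theorem edgeSum_append {V : Type u} [DecidableEq V] {G : SimpleGraph V} {x y z : V}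
    (p : G.Walk x y) (q : G.Walk y z) : edgeSum (p.append q) = edgeSum p + edgeSum q := by
  simp [edgeSum]

theorem edgeSum_reverse {V : Type u} [DecidableEq V] {G : SimpleGraph V} {x y : V}
    (p : G.Walk x y) : edgeSum p.reverse = edgeSum p := by
  simp [edgeSum, List.sum_reverse]

/-- If `pot` assigns to every vertex a vector such that each edge is congruent modulo `S` to the
difference of the values at its ends, then the edge sum of every closed walk lies in `S`. -/
theorem edgeSum_add_mem {V : Type u} [DecidableEq V] {G : SimpleGraph V}
    {S : Submodule (ZMod 2) (Sym2 V → ZMod 2)} (pot : V → Sym2 V → ZMod 2)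
    (h : ∀ x y, G.Adj x y → Pi.single s(x, y) 1 + (pot x + pot y) ∈ S) {x y : V}
    (p : G.Walk x y) : edgeSum p + (pot x + pot y) ∈ S := by
  induction p with
  | nil => simp [edgeSum, ZModModule.add_self]
  | @cons x y z hadj p ih =>
    have := S.add_mem (h x y hadj) ih
    rw [edgeSum_cons]
    convert this using 1
    have h2 := ZModModule.add_self (pot y)
    linear_combination -h2

namespace SubK

/-- The edges of `K_n`. -/
abbrev KEdge (n : ℕ) := {p : Fin n × Fin n // p.1 < p.2}

/-- The vertex set of `subK n k`. -/
abbrev Vert (n k : ℕ) := Fin n ⊕ (KEdge n × Fin k)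

variable {n k : ℕ}

/-- The `m`-th vertex (`0 ≤ m ≤ k + 1`) on the path replacing the edge `e` of `K_n`. -/
def seq (k : ℕ) (e : KEdge n) (m : ℕ) : Vert n k :=
  if m = 0 then Sum.inl e.1.1
  else if h : m - 1 < k then Sum.inr (e, ⟨m - 1, h⟩) else Sum.inl e.1.2

@[simp] theorem seq_zero (e : KEdge n) : seq k e 0 = Sum.inl e.1.1 := by simp [seq]

theorem seq_succ (e : KEdge n) {c : ℕ} (h : c < k) : seq k e (c + 1) = Sum.inr (e, ⟨c, h⟩) := by
  simp [seq, h]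

@[simp] theorem seq_last (e : KEdge n) : seq k e (k + 1) = Sum.inl e.1.2 := by simp [seq]

theorem kedge_ext {e e' : KEdge n} (h1 : e.1.1 = e'.1.1) (h2 : e.1.2 = e'.1.2) : e = e' :=
  Subtype.ext (Prod.ext h1 h2)

theorem seq_eq_inr {e : KEdge n} {m : ℕ} {x : KEdge n × Fin k} (h : seq k e m = Sum.inr x) :
    x.1 = e ∧ m = x.2 + 1 := by
  unfold seq at h
  split_ifs at h
  obtain rfl := Sum.inr.inj h
  exact ⟨rfl, by simp; omega⟩

theorem seq_eq_inl {e : KEdge n} {m : ℕ} (hm : m ≤ k + 1) {i : Fin n}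
    (h : seq k e m = Sum.inl i) : (m = 0 ∧ e.1.1 = i) ∨ (m = k + 1 ∧ e.1.2 = i) := by
  unfold seq at h
  split_ifs at h with h1 h2
  · exact Or.inl ⟨h1, Sum.inl.inj h⟩
  · exact Or.inr ⟨by omega, Sum.inl.inj h⟩

/-- Two different positions can only name the same vertex if it is a branch vertex. -/
theorem seq_eq_seq {e e' : KEdge n} {m m' : ℕ} (hm : m ≤ k + 1) (hm' : m' ≤ k + 1)
    (h : seq k e m = seq k e' m') :
    (e = e' ∧ m = m') ∨ ((m = 0 ∨ m = k + 1) ∧ (m' = 0 ∨ m' = k + 1)) := by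
  rcases hv : seq k e' m' with i | x
  · rw [hv] at h
    have := seq_eq_inl hm h
    have := seq_eq_inl hm' hv
    tauto
  · rw [hv] at h
    have := seq_eq_inr h
    have := seq_eq_inr hv
    left
    exact ⟨by simp_all, by omega⟩

theorem seq_injOn (e : KEdge n) {m m' : ℕ} (hm : m ≤ k + 1) (hm' : m' ≤ k + 1)
    (h : seq k e m = seq k e m') : m = m' := by
  have hne : e.1.1 ≠ e.1.2 := e.2.ne
  rcases seq_eq_seq hm hm' h with h' | ⟨rfl | rfl, rfl | rfl⟩
  · exact h'.2
  · rfl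
  · simp [hne] at h
  · simp [hne.symm] at h
  · rfl

theorem adj_seq (e : KEdge n) {m : ℕ} (hm : m ≤ k) :
    (subK n k).Adj (seq k e m) (seq k e (m + 1)) := by
  rw [subK, fromRel_adj]
  refine ⟨fun h => by simpa using seq_injOn e (by omega) (by omega) h, ?_⟩
  rcases m with _ | c
  · rcases Nat.eq_zero_or_pos k with rfl | hk
    · left
      simp [e.2]
    · left; simp [seq_succ e hk]
  · have hc : c < k := hm
    rcases Nat.lt_or_ge (c + 1) k with h | h
    · left; simp [seq_succ e hc, seq_succ e h]
    · obtain rfl : k = c + 1 := by omega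
      right; simp [seq_succ e hc]

theorem adj_iff {u v : Vert n k} : (subK n k).Adj u v ↔ ∃ e : KEdge n, ∃ m ≤ k,
    (u = seq k e m ∧ v = seq k e (m + 1)) ∨ (v = seq k e m ∧ u = seq k e (m + 1)) := by
  refine ⟨fun h => ?_, ?_⟩
  · rw [subK, fromRel_adj] at h
    have key : ∀ u v : Vert n k, (match u, v with
        | Sum.inl i, Sum.inl j => i < j ∧ k = 0
        | Sum.inl i, Sum.inr (e, c) =>
            (e.val.1 = i ∧ (c : ℕ) = 0) ∨ (e.val.2 = i ∧ (c : ℕ) = k - 1)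
        | Sum.inr (e, c), Sum.inr (e', c') => e = e' ∧ (c' : ℕ) = (c : ℕ) + 1
        | _, _ => False) → ∃ e : KEdge n, ∃ m ≤ k,
        (u = seq k e m ∧ v = seq k e (m + 1)) ∨ (v = seq k e m ∧ u = seq k e (m + 1)) := by
      rintro (i | ⟨e, c⟩) (j | ⟨e', c'⟩) h
      · obtain ⟨hij, rfl⟩ := h
        refine ⟨⟨(i, j), hij⟩, 0, le_rfl, Or.inl ⟨by simp, ?_⟩⟩
        exact (seq_last (k := 0) ⟨(i, j), hij⟩).symm
      · rcases h with ⟨rfl, h⟩ | ⟨rfl, h⟩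
        · refine ⟨e', 0, by omega, Or.inl ⟨by simp, ?_⟩⟩
          rw [zero_add, ← zero_add 1, seq_succ e' (by omega)]
          simp [Fin.ext_iff, h]
        · have := c'.2
          refine ⟨e', c' + 1, by omega, Or.inr ⟨(seq_succ e' c'.2).symm, ?_⟩⟩
          rw [show (c' : ℕ) + 1 = k by omega, seq_last]
      · exact h.elim
      · obtain ⟨rfl, h⟩ := h
        have := c'.2
        refine ⟨e, c + 1, by omega, Or.inl ⟨(seq_succ e c.2).symm, ?_⟩⟩
        rw [← h, seq_succ e c'.2]
    rcases h.2 with h | h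
    · exact key u v h
    · obtain ⟨e, m, hm, h⟩ := key v u h
      exact ⟨e, m, hm, h.symm⟩
  · rintro ⟨e, m, hm, ⟨rfl, rfl⟩ | ⟨rfl, rfl⟩⟩
    · exact adj_seq e hm
    · exact (adj_seq e hm).symm

/-- Each subdivided edge is assigned to its smaller end. -/
def branch : Vert n k → Fin n
  | Sum.inl i => i
  | Sum.inr x => x.1.1.1

theorem branch_seq (e : KEdge n) {m : ℕ} (hm : m ≤ k) : branch (seq k e m) = e.1.1 := by
  rcases m with _ | c
  · simp [branch]
  · simp [seq_succ e hm, branch]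

theorem connIn_branch (i : Fin n) : ∀ x ∈ (branch ⁻¹' {i} : Set (Vert n k)),
    ∀ y ∈ (branch ⁻¹' {i} : Set (Vert n k)), ConnIn (subK n k) (branch ⁻¹' {i}) x y := by
  have hseq : ∀ (e : KEdge n) (m : ℕ), m ≤ k →
      ConnIn (subK n k) (branch ⁻¹' {e.1.1}) (seq k e 0) (seq k e m) := by
    intro e m
    induction m with
    | zero => exact fun _ => ⟨.nil, by simp [branch]⟩
    | succ m ih =>
      intro hm
      obtain ⟨p, hp⟩ := ih (by omega)
      refine ⟨p.concat (adj_seq e (by omega)), fun v hv => ?_⟩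
      simp only [Walk.support_concat, List.mem_append, List.mem_singleton] at hv
      rcases hv with hv | rfl
      · exact hp v hv
      · exact branch_seq e hm
  have key : ∀ x ∈ (branch ⁻¹' {i} : Set (Vert n k)),
      ConnIn (subK n k) (branch ⁻¹' {i}) (Sum.inl i) x := by
    rintro (j | ⟨e, c⟩) h
    · obtain rfl : j = i := h
      exact ⟨.nil, by simp [branch]⟩
    · obtain rfl : e.1.1 = i := h
      have := hseq e (c + 1) c.2
      rwa [seq_succ e c.2, seq_zero] at this
  intro x hx y hy
  obtain ⟨p, hp⟩ := key x hx
  obtain ⟨q, hq⟩ := key y hy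
  refine ⟨p.reverse.append q, fun v hv => ?_⟩
  rcases (Walk.mem_support_append_iff _ _).1 hv with hv | hv
  · exact hp v (by simpa using hv)
  · exact hq v hv

theorem le_ncard_bag [NeZero n] {ι : Type} {T : SimpleGraph ι} (td : TreeDecomp (subK n k) T) :
    ∃ t, n ≤ (td.bag t).ncard := by
  obtain ⟨t, ht⟩ := td.isTree.helly (Finset.univ : Finset (Fin n)) Finset.univ_nonempty
    (fun i => {t | (td.bag t ∩ branch ⁻¹' {i}).Nonempty})
    (fun i _ => td.isPathConvex_setOf_meets (connIn_branch i)) (by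
      have hlt : ∀ i j : Fin n, i < j → ({t | (td.bag t ∩ branch ⁻¹' {i}).Nonempty} ∩
          {t | (td.bag t ∩ branch ⁻¹' {j}).Nonempty}).Nonempty := by
        intro i j hij
        obtain ⟨t, h1, h2⟩ := td.exists_bag_adj (adj_seq ⟨(i, j), hij⟩ le_rfl)
        rw [seq_last] at h2
        exact ⟨t, ⟨_, h1, branch_seq _ le_rfl⟩, ⟨_, h2, rfl⟩⟩
      intro i _ j _
      rcases lt_trichotomy i j with h | rfl | h
      · exact hlt i j h
      · obtain ⟨t, ht⟩ := td.exists_bag (Sum.inl i)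
        exact ⟨t, ⟨_, ht, rfl⟩, ⟨_, ht, rfl⟩⟩
      · rw [Set.inter_comm]
        exact hlt j i h)
  refine ⟨t, ?_⟩
  have himg : branch '' td.bag t = Set.univ := by
    refine Set.eq_univ_of_forall fun i => ?_
    obtain ⟨x, hx, rfl⟩ := ht i (Finset.mem_univ i)
    exact ⟨x, hx, rfl⟩
  have := Set.ncard_image_le (f := branch) (Set.toFinite (td.bag t))
  rwa [himg, Set.ncard_univ, Nat.card_fin] at this

/-- The index tree: the paths of subdividing vertices, attached to a common root. -/
def parent : Option (KEdge n × Fin k) → Option (KEdge n × Fin k)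
  | none => none
  | some (e, c) => if (c : ℕ) = 0 then none else some (e, ⟨c - 1, by omega⟩)

/-- The depth of a vertex in the index tree. -/
def depth : Option (KEdge n × Fin k) → ℕ
  | none => 0
  | some (_, c) => c + 1

theorem depth_parent_lt {t : Option (KEdge n × Fin k)} (ht : t ≠ none) :
    depth (parent t) < depth t := by
  rcases t with _ | ⟨e, c⟩
  · exact absurd rfl ht
  · by_cases h : (c : ℕ) = 0 <;> (simp [parent, depth, h]; try omega)

/-- All branch vertices lie in the root bag; the others run along the subdivided edges. -/
def bag : Option (KEdge n × Fin k) → Set (Vert n k)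
  | none => Set.range Sum.inl
  | some (e, c) => {seq k e c, seq k e (c + 1), Sum.inl e.1.2}

/-- The bag at which the subtree of a vertex is rooted. -/
def top : Vert n k → Option (KEdge n × Fin k)
  | Sum.inl _ => none
  | Sum.inr x => some x

theorem mem_bag_top (v : Vert n k) : v ∈ bag (top v) := by
  rcases v with i | ⟨e, c⟩
  · exact ⟨i, rfl⟩
  · simp [bag, top, seq_succ e c.2]

theorem top_ne_of_mem_bag {v : Vert n k} {t : Option (KEdge n × Fin k)} (hv : v ∈ bag t)
    (ht : t ≠ top v) : t ≠ none := by
  rintro rfl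
  obtain ⟨i, rfl⟩ := hv
  exact ht rfl

theorem mem_bag_parent {v : Vert n k} {t : Option (KEdge n × Fin k)} (hv : v ∈ bag t)
    (ht : t ≠ top v) : v ∈ bag (parent t) := by
  rcases t with _ | ⟨e, c⟩
  · exact absurd rfl (top_ne_of_mem_bag hv ht)
  have hlast : Sum.inl e.1.2 ∈ (bag (parent (some (e, c))) : Set (Vert n k)) := by
    by_cases h : (c : ℕ) = 0 <;> simp [parent, bag, h]
  rcases hv with rfl | rfl | rfl
  · by_cases h : (c : ℕ) = 0
    · simp [parent, bag, h]
    · simp only [parent, bag, h, if_false]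
      rw [Nat.sub_add_cancel (by omega)]
      simp
  · rw [seq_succ e c.2] at ht
    exact absurd rfl ht
  · exact hlast

/-- A tree-decomposition of `subK n k` into bags of at most `max n 3` vertices. -/
def treeDecomp (n k : ℕ) : TreeDecomp (subK n k) (parentGraph (parent (n := n) (k := k))) where
  isTree := parentGraph_isTree depth none rfl fun _ => depth_parent_lt
  bag := bag
  exists_bag v := ⟨_, mem_bag_top v⟩
  exists_bag_adj u v h := by
    obtain ⟨e, m, hm, h⟩ := adj_iff.1 h
    have : ∃ t, seq k e m ∈ bag t ∧ seq k e (m + 1) ∈ bag t := by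
      rcases hm.lt_or_eq with hm | rfl
      · exact ⟨some (e, ⟨m, hm⟩), by simp [bag]⟩
      · rcases m with _ | m
        · refine ⟨none, by simp [bag], ?_⟩
          rw [seq_last]
          exact ⟨_, rfl⟩
        · exact ⟨some (e, ⟨m, by omega⟩), by simp [bag]⟩
    obtain ⟨t, h1, h2⟩ := this
    rcases h with ⟨rfl, rfl⟩ | ⟨rfl, rfl⟩
    exacts [⟨t, h1, h2⟩, ⟨t, h2, h1⟩]
  bag_sep t₁ t₃ p hp t₂ ht₂ v hv := by
    have hT : (parentGraph (parent (n := n) (k := k))).IsTree :=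
      parentGraph_isTree depth none rfl fun _ => depth_parent_lt
    exact hT.isAcyclic.support_subset_of_connIn (S := {t | v ∈ bag t})
      (parentGraph_connIn (top := top v) depth
        (fun _ ht htop => depth_parent_lt (top_ne_of_mem_bag ht htop))
        (fun _ ht htop => mem_bag_parent ht htop) hv.1 hv.2) p hp t₂ ht₂

theorem ncard_bag_le (hn : 3 ≤ n) (t : Option (KEdge n × Fin k)) : (bag t).ncard ≤ n := by
  rcases t with _ | ⟨e, c⟩
  · rw [bag, ← Set.image_univ]
    refine (Set.ncard_image_le Set.finite_univ).trans ?_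
    simp
  · exact (Set.ncard_insert_le _ _).trans
      ((Nat.add_le_add_right (Set.ncard_insert_le _ _) 1).trans (by simpa using hn))

theorem treewidth_subK (hn : 3 ≤ n) : treewidth (subK n k) = n - 1 := by
  have : NeZero n := ⟨by omega⟩
  have hmem : n - 1 ∈ {m | ∃ (ι : Type) (T : SimpleGraph ι) (td : TreeDecomp (subK n k) T),
      ∀ t, (td.bag t).ncard ≤ m + 1} :=
    ⟨_, _, treeDecomp n k, fun t => (ncard_bag_le hn t).trans (by omega)⟩
  refine le_antisymm (Nat.sInf_le hmem) (le_csInf ⟨_, hmem⟩ ?_)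
  rintro m ⟨ι, T, td, h⟩
  obtain ⟨t, ht⟩ := le_ncard_bag td
  have := h t
  omega

/-- The walk along the first `m` edges of the path replacing `e`. -/
def initialWalk (e : KEdge n) : (m : ℕ) → m ≤ k + 1 → (subK n k).Walk (seq k e 0) (seq k e m)
  | 0, _ => .nil
  | m + 1, hm => (initialWalk e m (by omega)).concat (adj_seq e (by omega))

theorem edges_initialWalk (e : KEdge n) : ∀ (m : ℕ) (hm : m ≤ k + 1),
    (initialWalk e m hm).edges =
      (List.range m).map fun l => s(seq k e l, seq k e (l + 1))
  | 0, _ => rfl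
  | m + 1, hm => by
    rw [initialWalk, Walk.edges_concat, edges_initialWalk e m, List.range_succ]
    simp

theorem support_initialWalk (e : KEdge n) : ∀ (m : ℕ) (hm : m ≤ k + 1),
    (initialWalk e m hm).support = (List.range (m + 1)).map (seq k e)
  | 0, _ => rfl
  | m + 1, hm => by
    rw [initialWalk, Walk.support_concat, support_initialWalk e m, List.range_succ (n := m + 1)]
    simp

/-- The path of `subK n k` replacing the edge `ab` of `K_n`. -/
def edgePath (k : ℕ) {a b : Fin n} (h : a < b) : (subK n k).Walk (Sum.inl a) (Sum.inl b) :=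
  (initialWalk ⟨(a, b), h⟩ (k + 1) le_rfl).copy (seq_zero _) (seq_last _)

theorem edges_edgePath {a b : Fin n} (h : a < b) : (edgePath k h).edges =
    (List.range (k + 1)).map fun l => s(seq k ⟨(a, b), h⟩ l, seq k ⟨(a, b), h⟩ (l + 1)) := by
  rw [edgePath, Walk.edges_copy, edges_initialWalk]

theorem length_edgePath {a b : Fin n} (h : a < b) : (edgePath k h).length = k + 1 := by
  rw [← Walk.length_edges, edges_edgePath]
  simp

theorem isPath_edgePath {a b : Fin n} (h : a < b) : (edgePath k h).IsPath := by
  rw [Walk.isPath_def, edgePath, Walk.support_copy, support_initialWalk]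
  refine List.Nodup.map_on (fun x hx y hy hxy => ?_) List.nodup_range
  rw [List.mem_range] at hx hy
  exact seq_injOn _ (by omega) (by omega) hxy

theorem mem_support_edgePath {a b : Fin n} (h : a < b) {v : Vert n k}
    (hv : v ∈ (edgePath k h).support) :
    v = Sum.inl a ∨ v = Sum.inl b ∨ ∃ c, v = Sum.inr (⟨(a, b), h⟩, c) := by
  rw [edgePath, Walk.support_copy, support_initialWalk, List.mem_map] at hv
  obtain ⟨m, hm, rfl⟩ := hv
  rw [List.mem_range] at hm
  rcases hv : seq k ⟨(a, b), h⟩ m with i | ⟨e, c⟩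
  · rcases seq_eq_inl (by omega) hv with ⟨-, rfl⟩ | ⟨-, rfl⟩ <;> simp
  · obtain ⟨rfl, -⟩ := seq_eq_inr hv
    exact Or.inr (Or.inr ⟨c, rfl⟩)

/-- The cycle of `subK n k` arising from a triangle of `K_n`. -/
def triangle (k : ℕ) {a b c : Fin n} (hab : a < b) (hbc : b < c) :
    (subK n k).Walk (Sum.inl a) (Sum.inl a) :=
  ((edgePath k hab).append (edgePath k hbc)).append (edgePath k (hab.trans hbc)).reverse

theorem length_triangle {a b c : Fin n} (hab : a < b) (hbc : b < c) :
    (triangle k hab hbc).length = 3 * (k + 1) := by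
  simp only [triangle, Walk.length_append, Walk.length_reverse, length_edgePath]
  ring

theorem isCycle_triangle {a b c : Fin n} (hab : a < b) (hbc : b < c) :
    (triangle k hab hbc).IsCycle := by
  have hac := hab.trans hbc
  have h1 : ((edgePath k hab).append (edgePath k hbc)).IsPath := by
    rw [Walk.isPath_def, Walk.support_append, List.nodup_append']
    refine ⟨(isPath_edgePath hab).support_nodup, (isPath_edgePath hbc).support_nodup.tail, ?_⟩
    intro v hv hv'
    obtain ⟨hv', hvb⟩ := (isPath_edgePath hbc).mem_support_tail hv'
    rcases mem_support_edgePath hab hv with rfl | rfl | ⟨_, rfl⟩ <;>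
      rcases mem_support_edgePath hbc hv' with h | h | ⟨_, h⟩ <;>
      simp [hab.ne, hac.ne] at h hvb
  have h2 := (isPath_edgePath (k := k) hac).reverse
  refine h1.isCycle_append h2 ?_ ?_
  · intro v hv hv'
    obtain ⟨hv, hva⟩ := h1.mem_support_tail hv
    obtain ⟨hv', hvc⟩ := h2.mem_support_tail hv'
    rw [Walk.support_reverse, List.mem_reverse] at hv'
    rcases (Walk.mem_support_append_iff _ _).1 hv with hv | hv
    · rcases mem_support_edgePath hab hv with rfl | rfl | ⟨_, rfl⟩ <;>
        rcases mem_support_edgePath hac hv' with h | h | ⟨_, h⟩ <;>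
        simp [hab.ne', hbc.ne] at h hva
    · rcases mem_support_edgePath hbc hv with rfl | rfl | ⟨_, rfl⟩ <;>
        rcases mem_support_edgePath hac hv' with h | h | ⟨_, h⟩ <;>
        simp [hab.ne', hbc.ne] at h hvc
  · left
    rw [Walk.length_append, length_edgePath, length_edgePath]
    omega

/-- The sum of the first `m` edges of the path replacing `e`. -/
def initialSum (k : ℕ) (e : KEdge n) (m : ℕ) : Sym2 (Vert n k) → ZMod 2 :=
  ∑ l ∈ Finset.range m, Pi.single s(seq k e l, seq k e (l + 1)) 1

theorem edgeSum_edgePath {a b : Fin n} (h : a < b) :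
    edgeSum (edgePath k h) = initialSum k ⟨(a, b), h⟩ (k + 1) := by
  rw [edgeSum, edges_edgePath, List.map_map, initialSum]
  rfl

/-- The edge sum of a path from the branch vertex `0` to a branch vertex. -/
def branchPot (k : ℕ) [NeZero n] (i : Fin n) : Sym2 (Vert n k) → ZMod 2 :=
  if h : 0 < i then initialSum k ⟨(0, i), h⟩ (k + 1) else 0

/-- The edge sum of a path from the branch vertex `0` to a given vertex. -/
def pot [NeZero n] : Vert n k → Sym2 (Vert n k) → ZMod 2
  | Sum.inl i => branchPot k i
  | Sum.inr (e, c) => branchPot k e.1.1 + initialSum k e (c + 1)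

theorem pot_seq [NeZero n] (e : KEdge n) {m : ℕ} (hm : m ≤ k) :
    pot (seq k e m) = branchPot k e.1.1 + initialSum k e m := by
  rcases m with _ | m
  · simp [pot, initialSum]
  · rw [seq_succ e hm, pot]

theorem triangle_mem [NeZero n] (e : KEdge n) :
    initialSum k e (k + 1) + (branchPot k e.1.1 + branchPot k e.1.2) ∈
      Submodule.span (ZMod 2) (cycleChars (subK n k) (3 * (k + 1))) := by
  obtain ⟨⟨i, j⟩, hij⟩ := e
  change i < j at hij
  have hj : 0 < j := (Fin.zero_le i).trans_lt hij
  by_cases hi : 0 < i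
  · refine Submodule.subset_span ⟨_, triangle k hi hij, isCycle_triangle hi hij,
      (length_triangle hi hij).le, ?_⟩
    rw [walkChar_eq_edgeSum (isCycle_triangle hi hij).isTrail, triangle, edgeSum_append,
      edgeSum_append, edgeSum_reverse, edgeSum_edgePath, edgeSum_edgePath, edgeSum_edgePath]
    simp only [branchPot, hi, hj, dif_pos]
    abel
  · obtain rfl : i = 0 := le_antisymm (not_lt.1 hi) (Fin.zero_le i)
    simp [branchPot, hj, ZModModule.add_self]

theorem single_add_pot_mem [NeZero n] (x y : Vert n k) (h : (subK n k).Adj x y) :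
    Pi.single s(x, y) 1 + (pot x + pot y) ∈
      Submodule.span (ZMod 2) (cycleChars (subK n k) (3 * (k + 1))) := by
  obtain ⟨e, m, hm, h⟩ := adj_iff.1 h
  have key : Pi.single s(seq k e m, seq k e (m + 1)) 1 +
      (pot (seq k e m) + pot (seq k e (m + 1))) ∈
      Submodule.span (ZMod 2) (cycleChars (subK n k) (3 * (k + 1))) := by
    rw [pot_seq e hm]
    rcases hm.lt_or_eq with hlt | hmk
    · rw [pot_seq e hlt, initialSum, initialSum, Finset.sum_range_succ]
      convert Submodule.zero_mem _ using 1
      have h1 := ZModModule.add_self (branchPot k e.1.1)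
      have h2 := ZModModule.add_self
        (∑ l ∈ Finset.range m, Pi.single (M := fun _ => ZMod 2) s(seq k e l, seq k e (l + 1)) 1)
      have h3 := ZModModule.add_self
        (Pi.single (M := fun _ => ZMod 2) s(seq k e m, seq k e (m + 1)) 1)
      linear_combination h1 + h2 + h3
    · subst m
      have hlast : pot (seq k e (k + 1)) = branchPot k e.1.2 := by rw [seq_last, pot]
      convert triangle_mem e using 1
      rw [hlast, initialSum, initialSum, Finset.sum_range_succ]
      abel
  rcases h with ⟨rfl, rfl⟩ | ⟨rfl, rfl⟩
  · exact key
  · rwa [Sym2.eq_swap, add_comm (pot _)]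

theorem generatesLE (hn : 0 < n) : GeneratesLE (subK n k) (3 * (k + 1)) := by
  have : NeZero n := ⟨hn.ne'⟩
  intro v p hp
  have := edgeSum_add_mem pot single_add_pot_mem p
  rwa [ZModModule.add_self, add_zero, ← walkChar_eq_edgeSum hp.isTrail] at this

/-- The `m`-th edge of the path replacing `e`. -/
def seqEdge (k : ℕ) (e : KEdge n) (m : ℕ) : Sym2 (Vert n k) := s(seq k e m, seq k e (m + 1))

theorem seqEdge_injective {e e' : KEdge n} {m m' : ℕ} (hm : m ≤ k) (hm' : m' ≤ k)
    (h : seqEdge k e m = seqEdge k e' m') : e = e' ∧ m = m' := by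
  have hlt := e.2
  have hlt' := e'.2
  rcases Sym2.eq_iff.1 h with ⟨h1, h2⟩ | ⟨h1, h2⟩
  · rcases seq_eq_seq (by omega) (by omega) h1 with h | h
    · exact h
    rcases seq_eq_seq (by omega) (by omega) h2 with h' | h'
    · exact ⟨h'.1, by omega⟩
    obtain rfl : m = 0 := by omega
    obtain rfl : m' = 0 := by omega
    obtain rfl : k = 0 := by omega
    rw [seq_zero, seq_zero] at h1
    rw [seq_last, seq_last] at h2
    exact ⟨kedge_ext (Sum.inl.inj h1) (Sum.inl.inj h2), rfl⟩
  · rcases seq_eq_seq (by omega) (by omega) h1 with ⟨rfl, h⟩ | h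
    · have := seq_injOn e (by omega) (by omega) h2
      omega
    · rcases seq_eq_seq (by omega) (by omega) h2 with ⟨rfl, h'⟩ | h'
      · have := seq_injOn e (by omega) (by omega) h1
        omega
      obtain rfl : m = 0 := by omega
      obtain rfl : m' = 0 := by omega
      obtain rfl : k = 0 := by omega
      rw [seq_zero, seq_last] at h1
      rw [seq_zero, seq_last] at h2
      have := Sum.inl.inj h1
      have := Sum.inl.inj h2
      omega

theorem exists_seqEdge_of_mem_edges {x y : Vert n k} {p : (subK n k).Walk x y}
    {f : Sym2 (Vert n k)} (h : f ∈ p.edges) : ∃ e, ∃ m ≤ k, f = seqEdge k e m := by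
  induction f with
  | _ u v =>
    obtain ⟨e, m, hm, ⟨rfl, rfl⟩ | ⟨rfl, rfl⟩⟩ := adj_iff.1 (p.adj_of_mem_edges h)
    · exact ⟨e, m, hm, rfl⟩
    · exact ⟨e, m, hm, Sym2.eq_swap⟩

/-- A cycle passing through an interior vertex of a subdivided edge uses both edges there. -/
theorem seqEdge_mem_edges_iff {x : Vert n k} {p : (subK n k).Walk x x} (hp : p.IsCycle)
    (e : KEdge n) {m : ℕ} (hm : m < k) :
    seqEdge k e m ∈ p.edges ↔ seqEdge k e (m + 1) ∈ p.edges := by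
  have key : ∀ b, s(seq k e (m + 1), b) ∈ p.edges →
      b = seq k e m ∨ b = seq k e (m + 2) := by
    intro b hb
    obtain ⟨e', m', hm', ⟨h1, h2⟩ | ⟨h1, h2⟩⟩ := adj_iff.1 (p.adj_of_mem_edges hb)
    · rcases seq_eq_seq (by omega) (by omega) h1 with ⟨rfl, rfl⟩ | h
      · exact Or.inr h2
      · omega
    · rcases seq_eq_seq (by omega) (by omega) h2 with ⟨rfl, h⟩ | h
      · obtain rfl : m = m' := by omega
        exact Or.inl h1
      · omega
  constructor <;> intro h
  · rw [seqEdge, Sym2.eq_swap] at h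
    obtain ⟨b, hb, hmem⟩ := hp.exists_ne_mem_edges h
    obtain rfl := (key b hmem).resolve_left hb
    exact hmem
  · obtain ⟨b, hb, hmem⟩ := hp.exists_ne_mem_edges h
    obtain rfl := (key b hmem).resolve_right hb
    rwa [Sym2.eq_swap] at hmem

theorem seqEdge_zero_mem_edges_iff {x : Vert n k} {p : (subK n k).Walk x x} (hp : p.IsCycle)
    (e : KEdge n) {m : ℕ} (hm : m ≤ k) :
    seqEdge k e 0 ∈ p.edges ↔ seqEdge k e m ∈ p.edges := by
  induction m with
  | zero => rfl
  | succ m ih => exact (ih (by omega)).trans (seqEdge_mem_edges_iff hp e hm)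

/-- A cycle cannot end in a branch vertex. -/
theorem exists_kedge_ne {x : Vert n k} {p : (subK n k).Walk x x} (hp : p.IsCycle)
    {e : KEdge n} (he : seqEdge k e 0 ∈ p.edges) {i : Fin n} (hi : i = e.1.1 ∨ i = e.1.2) :
    ∃ e' ≠ e, seqEdge k e' 0 ∈ p.edges ∧ (i = e'.1.1 ∨ i = e'.1.2) := by
  have hne := e.2.ne
  obtain ⟨a, ha, ha'⟩ : ∃ a, s(Sum.inl i, a) ∈ p.edges ∧
      a = if i = e.1.1 then seq k e 1 else seq k e k := by
    refine ⟨_, ?_, rfl⟩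
    rcases hi with rfl | rfl
    · simpa [seqEdge] using he
    · rw [seqEdge_zero_mem_edges_iff hp e le_rfl, seqEdge, seq_last, Sym2.eq_swap] at he
      rwa [if_neg hne.symm]
  obtain ⟨b, hba, hb⟩ := hp.exists_ne_mem_edges ha
  obtain ⟨e', m, hm, h⟩ := adj_iff.1 (p.adj_of_mem_edges hb)
  have hfull : seqEdge k e' 0 ∈ p.edges := by
    rw [seqEdge_zero_mem_edges_iff hp e' hm, seqEdge]
    rcases h with ⟨h1, h2⟩ | ⟨h1, h2⟩
    · rwa [← h1, ← h2]
    · rwa [← h1, ← h2, Sym2.eq_swap]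
  rcases h with ⟨h1, h2⟩ | ⟨h1, h2⟩
  · rcases seq_eq_inl (by omega) h1.symm with ⟨rfl, h3⟩ | ⟨h3, -⟩
    · refine ⟨e', ?_, hfull, Or.inl h3.symm⟩
      rintro rfl
      rw [if_pos h3.symm] at ha'
      exact hba (h2.trans ha'.symm)
    · omega
  · rcases seq_eq_inl (by omega) h2.symm with ⟨h3, -⟩ | ⟨h3, h4⟩
    · omega
    · refine ⟨e', ?_, hfull, Or.inr h4.symm⟩
      rintro rfl
      obtain rfl : m = k := by omega
      rw [if_neg (by rw [← h4]; exact hne.symm)] at ha'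
      exact hba (h1.trans ha'.symm)

theorem le_length_of_isCycle {x : Vert n k} {p : (subK n k).Walk x x} (hp : p.IsCycle) :
    3 * (k + 1) ≤ p.length := by
  obtain ⟨f, hf⟩ : ∃ f, f ∈ p.edges := by
    refine List.exists_mem_of_length_pos ?_
    rw [Walk.length_edges]
    have := hp.three_le_length
    omega
  obtain ⟨e, m, hm, rfl⟩ := exists_seqEdge_of_mem_edges hf
  rw [← seqEdge_zero_mem_edges_iff hp e hm] at hf
  obtain ⟨e₁, h₁, hf₁, hi₁⟩ := exists_kedge_ne hp hf (Or.inl rfl)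
  obtain ⟨j, hj, hje⟩ : ∃ j, (j = e₁.1.1 ∨ j = e₁.1.2) ∧ j ≠ e.1.1 := by
    have := e₁.2.ne
    rcases hi₁ with h | h
    · exact ⟨e₁.1.2, Or.inr rfl, by rw [h]; exact this.symm⟩
    · exact ⟨e₁.1.1, Or.inl rfl, by rw [h]; exact this⟩
  have hje' : j ≠ e.1.2 := by
    intro h
    apply h₁
    have := e.2
    have := e₁.2
    apply kedge_ext <;> omega
  obtain ⟨e₂, h₂, hf₂, hi₂⟩ := exists_kedge_ne hp hf₁ hj
  have h₂' : e₂ ≠ e := by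
    rintro rfl
    exact hi₂.elim hje hje'
  have hcard : ({e, e₁, e₂} : Finset (KEdge n)).card = 3 :=
    Finset.card_eq_three.2 ⟨e, e₁, e₂, h₁.symm, h₂'.symm, h₂.symm, rfl⟩
  calc 3 * (k + 1) = (({e, e₁, e₂} : Finset (KEdge n)) ×ˢ Finset.range (k + 1)).card := by
        rw [Finset.card_product, hcard, Finset.card_range]
    _ ≤ p.edges.toFinset.card := by
        refine Finset.card_le_card_of_injOn (fun q => seqEdge k q.1 q.2) ?_ ?_
        · rintro ⟨e', m'⟩ h
          simp only [Finset.coe_product, Set.mem_prod, Finset.mem_coe, Finset.mem_insert,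
            Finset.mem_singleton, Finset.mem_range] at h
          obtain ⟨h, hm'⟩ := h
          simp only [List.coe_toFinset, Set.mem_ofPred_eq]
          rw [← seqEdge_zero_mem_edges_iff hp e' (by omega)]
          rcases h with rfl | rfl | rfl <;> assumption
        · rintro ⟨e', m'⟩ h ⟨e'', m''⟩ h' heq
          simp only [Finset.coe_product, Set.mem_prod, Finset.mem_coe, Finset.mem_range] at h h'
          obtain ⟨rfl, rfl⟩ := seqEdge_injective (by omega) (by omega) heq
          rfl
    _ ≤ p.edges.length := List.toFinset_card_le _
    _ = p.length := p.length_edges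

theorem ellGraph_subK (hn : 3 ≤ n) : ellGraph (subK n k) = 3 * (k + 1) := by
  have hgen : 3 * (k + 1) ∈ {ℓ | GeneratesLE (subK n k) ℓ} := generatesLE (by omega)
  refine le_antisymm (Nat.sInf_le hgen) (le_csInf ⟨_, hgen⟩ fun ℓ hℓ => ?_)
  by_contra! hlt
  have hempty : cycleChars (subK n k) ℓ = ∅ := by
    refine Set.eq_empty_of_forall_notMem ?_
    rintro f ⟨v, p, hp, hlen, -⟩
    have := le_length_of_isCycle hp
    omega
  have h01 : (⟨0, by omega⟩ : Fin n) < ⟨1, by omega⟩ := by simp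
  have h12 : (⟨1, by omega⟩ : Fin n) < ⟨2, by omega⟩ := by simp
  have hc := isCycle_triangle (k := k) h01 h12
  have hmem := hℓ _ hc
  rw [hempty, Submodule.span_empty, Submodule.mem_bot] at hmem
  obtain ⟨f, hf⟩ : ∃ f, f ∈ (triangle k h01 h12).edges := by
    refine List.exists_mem_of_length_pos ?_
    rw [Walk.length_edges, length_triangle]
    omega
  have := congrFun hmem f
  simp [walkChar, hf] at this

end SubK

/-- for the `k`-fold subdivision `G` of `K_n` (`n ≥ 3`),
`tw(G) = n − 1` and `ℓ(G) = 3(k + 1)`. -/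
theorem subK_tw_ell (n k : ℕ) (hn : 3 ≤ n) :
    treewidth (subK n k) = n - 1 ∧ ellGraph (subK n k) = 3 * (k + 1) := by
  exact ⟨SubK.treewidth_subK hn, SubK.ellGraph_subK hn⟩
end
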